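/- Let φ be a bijection of the set of lines of a 3-dimensional classical elliptic space onto itself such that for all lines a, b, if a ∼ b then φ(a) ∼ φ(b). Then φ is an elliptic Plücker transformation, i.e., for all lines a, b one has a ∼ b if and only if φ(a) ∼ φ(b). -/

import Mathlib

/-- A *line* of `PG(3,F)`: a 2-dimensional `F`-subspace of a 4-dimensional vector space `V`. -/
def ELine (F V : Type*) [Field F] [AddCommGroup V] [Module F V] :=
  {W : Submodule F V // Module.finrank F W = 2}

variable {F V : Type*} [Field F] [AddCommGroup V] [Module F V]

/-- `a ≈ b`: the subspaces `a` and `b` intersect orthogonally (w.r.t. the polarity of `B`):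
`a ⊓ b ≠ ⊥` and `a ⊓ bᗮ ≠ ⊥`. -/
def OrthoMeet (B : LinearMap.BilinForm F V) (a b : Submodule F V) : Prop :=
  a ⊓ b ≠ ⊥ ∧ a ⊓ B.orthogonal b ≠ ⊥

/-- `a ∼ b`: the lines `a` and `b` are related, i.e. `a ≈ b` or `a = b`. -/
def Related (B : LinearMap.BilinForm F V) (a b : Submodule F V) : Prop :=
  OrthoMeet B a b ∨ a = b

/-- `a ∥ b`: `a` and `b` are Clifford parallel, i.e. there are at least three lines `x`
with `x ≈ a` and `x ≈ b`. -/
def CliffPar (B : LinearMap.BilinForm F V) (a b : Submodule F V) : Prop :=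
  ∃ x y z : Submodule F V,
    Module.finrank F x = 2 ∧ Module.finrank F y = 2 ∧ Module.finrank F z = 2 ∧
    x ≠ y ∧ x ≠ z ∧ y ≠ z ∧
    OrthoMeet B x a ∧ OrthoMeet B x b ∧
    OrthoMeet B y a ∧ OrthoMeet B y b ∧
    OrthoMeet B z a ∧ OrthoMeet B z b

/-- The elliptic space is *classical*: there exist Clifford parallel lines `a, b`
with `b ∉ {a, aᗮ}`. -/
def IsClassical (B : LinearMap.BilinForm F V) : Prop :=
  ∃ a b : Submodule F V, Module.finrank F a = 2 ∧ Module.finrank F b = 2 ∧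
    CliffPar B a b ∧ b ≠ a ∧ b ≠ B.orthogonal a

/-- Synthetic properties of the elliptic plane used in the proof. -/
structure EPl {P : Type*} (pp cl : P → P → Prop) : Prop where
  sym : ∀ {X Y}, pp X Y → pp Y X
  irr : ∀ X, ¬ pp X X
  pole : ∀ X Y, ∃ W, pp W X ∧ pp W Y
  uniq : ∀ {X Y W W'}, X ≠ Y → pp W X → pp W Y → pp W' X → pp W' Y → W = W'
  crefl : ∀ X, cl X X
  csym : ∀ {X Y}, cl X Y → cl Y X
  ctrans : ∀ {X Y Z}, cl X Y → cl Y Z → cl X Z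
  rot : ∀ {X Y}, cl X Y → ∃ s : P → P, s X = Y ∧ (∀ U W, pp U W → pp (s U) (s W)) ∧ ∀ U, cl (s U) U
  three : ∀ {X K}, pp X K → ∃ X1 X2, X1 ≠ X ∧ X2 ≠ X ∧ X1 ≠ X2 ∧ pp X1 K ∧ pp X2 K ∧ cl X1 X ∧ cl X2 X
  harm : ∀ {X C}, X ≠ C → ¬ pp X C → ∃ O C' K X'', pp O X ∧ pp O C ∧ pp C' O ∧ pp C' C ∧
    pp K O ∧ pp K X ∧ X'' ≠ X ∧ cl X'' X ∧ pp X'' O ∧ ∀ A, pp A K → A ≠ O → A ≠ X →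
      ∃ D E K1 K2 K3, pp D C ∧ pp D K1 ∧ pp A K1 ∧ pp C K1 ∧ pp E C' ∧
        pp K2 A ∧ pp K2 C' ∧ pp K2 E ∧ pp K3 D ∧ pp K3 E ∧ pp K3 X''

namespace EPl

theorem ne {P : Type*} {pp cl : P → P → Prop} (h : EPl pp cl) {X Y : P} (hp : pp X Y) : X ≠ Y := by
  rintro rfl; exact h.irr _ hp

theorem two {P : Type*} {pp cl : P → P → Prop} (h : EPl pp cl) {X Y x : P} (hc : cl X Y)
    (hp : pp x X) : ∃ y1 y2, y1 ≠ y2 ∧ pp y1 Y ∧ pp y2 Y ∧ cl x y1 ∧ cl x y2 := by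
  obtain ⟨s, rfl, h1, h2⟩ := h.rot hc
  obtain ⟨a, b, ha, hb, hab, pa, pb, ca, cb⟩ := h.three (h1 _ _ hp)
  exact ⟨a, b, hab, pa, pb, h.csym (h.ctrans ca (h2 _)), h.csym (h.ctrans cb (h2 _))⟩

/-- class-injective perp-preserving maps are injective -/
theorem inj {P : Type*} {pp cl : P → P → Prop} (h : EPl pp cl) (f : P → P)
    (hf : ∀ X Y, pp X Y → pp (f X) (f Y)) (hi : ∀ X Y, cl X Y → f X = f Y → X = Y)
    {X C : P} (hXC : f X = f C) : X = C := by
  by_contra hne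
  have hnp : ¬ pp X C := fun hp => h.irr (f C) (by simpa [hXC] using hf _ _ hp)
  obtain ⟨O, C', K, X2, hOX, hOC, hC'O, hC'C, hKO, hKX, hX2, hcX2, hX2O, hA⟩ := h.harm hne hnp
  obtain ⟨A, hAK, hfAO, hfAX⟩ : ∃ A, pp A K ∧ f A ≠ f O ∧ f A ≠ f X := by
    obtain ⟨a, b, ha, hb, hab, pa, pb, ca, cb⟩ := h.three (h.sym hKX)
    by_cases hq : f a = f O
    · refine ⟨b, pb, fun hb' => ?_, fun hb' => hb (hi _ _ cb hb')⟩
      exact hab (hi _ _ (h.ctrans ca (h.csym cb)) (hq.trans hb'.symm))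
    · exact ⟨a, pa, hq, fun ha' => ha (hi _ _ ca ha')⟩
  obtain ⟨D, E, K1, K2, K3, hDC, hDK1, hAK1, hCK1, hEC', hK2A, hK2C', hK2E, hK3D, hK3E, hK3X⟩ :=
    hA A hAK (fun e => hfAO (by rw [e])) (fun e => hfAX (by rw [e]))
  have hfAC : f A ≠ f C := hXC ▸ hfAX
  have S := @h.sym
  have fOC := hf _ _ hOC
  have fKX := hf _ _ hKX
  rw [hXC] at fKX
  have fKC' : f K = f C' := h.uniq (h.ne fOC) (hf _ _ hKO) fKX (hf _ _ hC'O) (hf _ _ hC'C)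
  have e1 : f K1 = f K := h.uniq hfAC (S (hf _ _ hAK1)) (S (hf _ _ hCK1)) (S (hf _ _ hAK)) fKX
  have e2 : f D = f O := h.uniq (h.ne fKX) (e1 ▸ hf _ _ hDK1) (hf _ _ hDC) (S (hf _ _ hKO)) fOC
  have hfAC' : pp (f A) (f C') := fKC' ▸ hf _ _ hAK
  have e3 : f E = f A := h.uniq (h.ne (hf _ _ hK2C')) (S (hf _ _ hK2E)) (hf _ _ hEC')
    (S (hf _ _ hK2A)) hfAC'
  have e4 : f K3 = f C' := h.uniq hfAO (e3 ▸ hf _ _ hK3E) (e2 ▸ hf _ _ hK3D) (S hfAC') (hf _ _ hC'O)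
  have e5 : f X2 = f C := h.uniq (h.ne (hf _ _ hC'O)) (e4 ▸ S (hf _ _ hK3X)) (hf _ _ hX2O)
    (S (hf _ _ hC'C)) (S fOC)
  exact hX2 (hi _ _ hcX2 (e5.trans hXC.symm))

theorem refl_perp {P : Type*} {pp cl : P → P → Prop} (h : EPl pp cl) (f : P → P)
    (hf : ∀ X Y, pp X Y → pp (f X) (f Y)) (hi : ∀ X Y, cl X Y → f X = f Y → X = Y)
    {X Y : P} (hp : pp (f X) (f Y)) : pp X Y := by
  by_contra hn
  obtain ⟨O, hOX, hOY⟩ := h.pole X Y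
  obtain ⟨Q, hQO, hQX⟩ := h.pole O X
  have hne : f Q ≠ f Y := fun e => by
    have := h.inj f hf hi e
    subst this
    exact hn (h.sym hQX)
  have : f O = f X := h.uniq hne (h.sym (hf _ _ hQO)) (hf _ _ hOY) (h.sym (hf _ _ hQX)) hp
  exact h.ne (hf _ _ hOX) this

/-- An injective adjacency-preserving map on pairs. -/
structure Good {P : Type*} (pp cl : P → P → Prop) (m n : P → P → P) : Prop where
  adj1 : ∀ {X Y X' Y'}, cl X Y → cl X' Y' → pp X X' → pp Y Y' → pp (m X Y) (m X' Y')
  adj2 : ∀ {X Y X' Y'}, cl X Y → cl X' Y' → pp X X' → pp Y Y' → pp (n X Y) (n X' Y')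
  inj1 : ∀ {X Y X' Y'}, cl X Y → cl X' Y' → m X Y = m X' Y' → n X Y = n X' Y' → X = X'
  inj2 : ∀ {X Y X' Y'}, cl X Y → cl X' Y' → m X Y = m X' Y' → n X Y = n X' Y' → Y = Y'

theorem Good.swap {P : Type*} {pp cl : P → P → Prop} {m n : P → P → P} (g : Good pp cl m n) :
    Good pp cl n m :=
  ⟨g.adj2, g.adj1, fun a b c d => g.inj1 a b d c, fun a b c d => g.inj2 a b d c⟩

theorem Good.flip {P : Type*} {pp cl : P → P → Prop} {m n : P → P → P} (h : EPl pp cl)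
    (g : Good pp cl m n) : Good pp cl (fun X Y => m Y X) (fun X Y => n Y X) :=
  ⟨fun a b c d => g.adj1 (h.csym a) (h.csym b) d c, fun a b c d => g.adj2 (h.csym a) (h.csym b) d c,
   fun a b c d => g.inj2 (h.csym a) (h.csym b) c d, fun a b c d => g.inj1 (h.csym a) (h.csym b) c d⟩

/-- rows are mapped to rows -/
def RowT {P : Type*} (cl : P → P → Prop) (m : P → P → P) (X : P) : Prop :=
  ∀ Y Y', cl X Y → cl X Y' → m X Y = m X Y'

theorem par {P : Type*} {pp cl : P → P → Prop} (h : EPl pp cl) {m n : P → P → P}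
    (g : Good pp cl m n) {X Y Y' : P} (hY : cl X Y) (hY' : cl X Y') :
    m X Y = m X Y' ∨ n X Y = n X Y' := by
  by_contra! hc
  obtain ⟨h1, h2⟩ := hc
  obtain ⟨W, hW, hW'⟩ := h.pole Y Y'
  obtain ⟨x1, x2, hx, p1, p2, c1, c2⟩ := h.two (h.csym hY) hW
  have e1 := h.uniq h1 (g.adj1 (h.csym c1) hY p1 hW) (g.adj1 (h.csym c1) hY' p1 hW')
    (g.adj1 (h.csym c2) hY p2 hW) (g.adj1 (h.csym c2) hY' p2 hW')
  have e2 := h.uniq h2 (g.adj2 (h.csym c1) hY p1 hW) (g.adj2 (h.csym c1) hY' p1 hW')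
    (g.adj2 (h.csym c2) hY p2 hW) (g.adj2 (h.csym c2) hY' p2 hW')
  exact hx (g.inj1 (h.csym c1) (h.csym c2) e1 e2)

theorem row_or {P : Type*} {pp cl : P → P → Prop} (h : EPl pp cl) {m n : P → P → P}
    (g : Good pp cl m n) (X : P) : RowT cl m X ∨ RowT cl n X := by
  by_contra! hc
  obtain ⟨h1, h2⟩ := hc
  unfold RowT at h1 h2
  push Not at h1 h2
  obtain ⟨a, b, ca, cb, hab⟩ := h1
  obtain ⟨c, d, cc, cd, hcd⟩ := h2
  have hab' := (h.par g ca cb).resolve_left hab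
  have hcd' := (h.par g cc cd).resolve_right hcd
  have q1 := h.par g ca cc
  have q2 := h.par g ca cd
  have q3 := h.par g cb cc
  have q4 := h.par g cb cd
  grind

theorem other {P : Type*} {pp cl : P → P → Prop} (h : EPl pp cl) (X : P) :
    ∃ Y, cl X Y ∧ Y ≠ X := by
  obtain ⟨W, hW, -⟩ := h.pole X X
  obtain ⟨a, b, ha, hb, hab, pa, pb, ca, cb⟩ := h.three (h.sym hW)
  exact ⟨a, h.csym ca, ha⟩

theorem row_not {P : Type*} {pp cl : P → P → Prop} (h : EPl pp cl) {m n : P → P → P}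
    (g : Good pp cl m n) (X : P) (h1 : RowT cl m X) (h2 : RowT cl n X) : False := by
  obtain ⟨Y, hY, hne⟩ := h.other X
  exact hne (g.inj2 hY (h.crefl X) (h1 _ _ hY (h.crefl X)) (h2 _ _ hY (h.crefl X)))

theorem mixed {P : Type*} {pp cl : P → P → Prop} (h : EPl pp cl) {m n : P → P → P}
    (g : Good pp cl m n) {X X' : P} (hp : pp X X') (h1 : RowT cl m X) (h2 : RowT cl n X')
    {x y : P} (hx : pp x X) (hy : cl x y) : n x y = n X' X' := by
  have key : ∀ Y, cl X Y → pp (n X' X') (n X Y) := by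
    intro Y hY
    obtain ⟨y1, y2, -, p1, -, c1, -⟩ := h.two hY (h.sym hp)
    rw [h2 _ _ (h.crefl X') c1]
    exact g.adj2 c1 hY (h.sym hp) p1
  obtain ⟨y1, y2, hne, p1, p2, c1, c2⟩ := h.two hy (h.sym hx)
  have hn : n X y1 ≠ n X y2 := fun e => hne (g.inj2 c1 c2 (h1 _ _ c1 c2) e)
  exact h.uniq hn (g.adj2 hy c1 hx (h.sym p1)) (g.adj2 hy c2 hx (h.sym p2)) (key _ c1) (key _ c2)

theorem same {P : Type*} {pp cl : P → P → Prop} (h : EPl pp cl) {m n : P → P → P}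
    (g : Good pp cl m n) {X X' : P} (hp : pp X X') (h1 : RowT cl m X) : RowT cl m X' := by
  refine (h.row_or g X').resolve_right fun h2 => ?_
  obtain ⟨x, hx, hx'⟩ := h.pole X X'
  refine h.row_not g x (fun Y Y' hY hY' => ?_) (fun Y Y' hY hY' => ?_)
  · rw [h.mixed g.swap (h.sym hp) h2 h1 hx' hY, h.mixed g.swap (h.sym hp) h2 h1 hx' hY']
  · rw [h.mixed g hp h1 h2 hx hY, h.mixed g hp h1 h2 hx hY']

theorem all {P : Type*} {pp cl : P → P → Prop} (h : EPl pp cl) {m n : P → P → P}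
    (g : Good pp cl m n) : (∀ X, RowT cl m X) ∨ (∀ X, RowT cl n X) := by
  by_contra! hc
  obtain ⟨⟨X, hX⟩, ⟨Y, hY⟩⟩ := hc
  have hX := (h.row_or g X).resolve_left hX
  obtain ⟨W, a, b⟩ := h.pole X Y
  exact hY (h.same g.swap b (h.same g.swap (h.sym a) hX))

theorem notboth {P : Type*} {pp cl : P → P → Prop} (h : EPl pp cl) {m n : P → P → P}
    (g : Good pp cl m n) (X : P) (h1 : ∀ X, RowT cl m X) (h2 : ∀ X, RowT cl (fun X Y => m Y X) X) :
    False := by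
  obtain ⟨X2, hc, hne⟩ := h.other X
  obtain ⟨W, a, b⟩ := h.pole X X2
  obtain ⟨y1, y2, hy, p1, p2, c1, c2⟩ := h.two (h.crefl X) a
  have em := h2 X _ _ (h.crefl X) hc
  have hn : n X X ≠ n X2 X := fun e => hne (g.inj1 (h.crefl X) (h.csym hc) em e).symm
  have := h.uniq hn (g.adj2 c1 (h.crefl X) a p1) (g.adj2 c1 (h.csym hc) b p1)
    (g.adj2 c2 (h.crefl X) a p2) (g.adj2 c2 (h.csym hc) b p2)
  exact hy (g.inj2 c1 c2 (h1 W _ _ c1 c2) this)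

theorem core1 {P : Type*} {pp cl : P → P → Prop} (h : EPl pp cl) {m n : P → P → P}
    (g : Good pp cl m n) (h1 : ∀ X, RowT cl m X) {X Y X' Y' : P} (hc : cl X Y) (hc' : cl X' Y')
    (hm : pp (m X Y) (m X' Y')) (hn : pp (n X Y) (n X' Y')) : pp X X' ∧ pp Y Y' := by
  have h2 : ∀ X, RowT cl (fun X Y => n Y X) X :=
    (h.all (g.flip h)).resolve_left fun h2 => h.notboth g X h1 h2
  constructor
  · refine h.refl_perp (fun X => m X X) (fun X Y hp => g.adj1 (h.crefl _) (h.crefl _) hp hp) ?_ ?_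
    · intro A B hAB e
      exact g.inj1 (Y := B) (Y' := B) hAB (h.crefl _) ((h1 _ _ _ hAB (h.crefl _)).trans e)
        (h2 B _ _ (h.csym hAB) (h.crefl _))
    · show pp (m X X) (m X' X')
      rwa [h1 X _ _ (h.crefl _) hc, h1 X' _ _ (h.crefl _) hc']
  · refine h.refl_perp (fun X => n X X) (fun X Y hp => g.adj2 (h.crefl _) (h.crefl _) hp hp) ?_ ?_
    · intro A B hAB e
      exact g.inj2 (X := B) (X' := B) (h.csym hAB) (h.crefl _) (h1 B _ _ (h.csym hAB) (h.crefl _))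
        ((h2 A _ _ hAB (h.crefl _)).trans e)
    · have := h2 Y _ _ (h.crefl _) (h.csym hc)
      have := h2 Y' _ _ (h.crefl _) (h.csym hc')
      simp_all

theorem core {P : Type*} {pp cl : P → P → Prop} (h : EPl pp cl) {m n : P → P → P}
    (g : Good pp cl m n) {X Y X' Y' : P} (hc : cl X Y) (hc' : cl X' Y')
    (hm : pp (m X Y) (m X' Y')) (hn : pp (n X Y) (n X' Y')) : pp X X' ∧ pp Y Y' := by
  rcases h.all g with h1 | h1
  · exact h.core1 g h1 hc hc' hm hn
  · exact h.core1 g.swap h1 hc hc' hn hm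

/-- Abstract form of the theorem. -/
theorem main {P L : Type*} {pp cl : P → P → Prop} (h : EPl pp cl) (l r : L → P)
    (hlr : ∀ a, cl (l a) (r a))
    (hex : ∀ X Y, cl X Y → ∃ a b, a ≠ b ∧ l a = X ∧ r a = Y ∧ l b = X ∧ r b = Y ∧
      ∀ c, l c = X → r c = Y → c = a ∨ c = b)
    (φ : L → L) (hinj : Function.Injective φ)
    (hφ : ∀ a b, pp (l a) (l b) → pp (r a) (r b) → pp (l (φ a)) (l (φ b)) ∧ pp (r (φ a)) (r (φ b)))
    (a b : L) (h1 : pp (l (φ a)) (l (φ b))) (h2 : pp (r (φ a)) (r (φ b))) :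
    pp (l a) (l b) ∧ pp (r a) (r b) := by
  have wd : ∀ a b, l a = l b → r a = r b → l (φ a) = l (φ b) ∧ r (φ a) = r (φ b) := by
    intro a b e1 e2
    obtain ⟨s, hs, hs1, hs2⟩ := h.rot (hlr a)
    obtain ⟨U, hU, -⟩ := h.pole (l a) (l a)
    obtain ⟨W, hW, hWU⟩ := h.pole (l a) U
    obtain ⟨c, -, -, c1, c2, -⟩ := hex U (s U) (h.csym (hs2 U))
    obtain ⟨d, -, -, d1, d2, -⟩ := hex W (s W) (h.csym (hs2 W))
    have ac := hφ a c (c1 ▸ h.sym hU) (by rw [c2, ← hs]; exact h.sym (hs1 _ _ hU))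
    have ad := hφ a d (d1 ▸ h.sym hW) (by rw [d2, ← hs]; exact h.sym (hs1 _ _ hW))
    have bc := hφ b c (c1 ▸ e1 ▸ h.sym hU) (by rw [c2, ← e2, ← hs]; exact h.sym (hs1 _ _ hU))
    have bd := hφ b d (d1 ▸ e1 ▸ h.sym hW) (by rw [d2, ← e2, ← hs]; exact h.sym (hs1 _ _ hW))
    have cd := hφ c d (by rw [c1, d1]; exact h.sym hWU) (by rw [c2, d2]; exact h.sym (hs1 _ _ hWU))
    exact ⟨h.uniq (h.ne cd.1) ac.1 ad.1 bc.1 bd.1, h.uniq (h.ne cd.2) ac.2 ad.2 bc.2 bd.2⟩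
  have wi : ∀ a b, l (φ a) = l (φ b) → r (φ a) = r (φ b) → l a = l b ∧ r a = r b := by
    intro a b e1 e2
    obtain ⟨c, d, hcd, c1, c2, d1, d2, -⟩ := hex _ _ (hlr a)
    obtain ⟨u, v, huv, u1, u2, v1, v2, H⟩ := hex _ _ (hlr (φ a))
    have wc := wd c a c1 c2
    have wdd := wd d a d1 d2
    have hc := H _ wc.1 wc.2
    have hd := H _ wdd.1 wdd.2
    have hb := H _ e1.symm e2.symm
    have hne : φ c ≠ φ d := fun e => hcd (hinj e)
    have : φ b = φ c ∨ φ b = φ d := by grind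
    rcases this with e | e
    · have := hinj e
      subst this
      exact ⟨c1.symm, c2.symm⟩
    · have := hinj e
      subst this
      exact ⟨d1.symm, d2.symm⟩
  have hch : ∀ X Y, ∃ a, cl X Y → l a = X ∧ r a = Y := by
    intro X Y
    by_cases hc : cl X Y
    · obtain ⟨a, -, -, a1, a2, -⟩ := hex X Y hc
      exact ⟨a, fun _ => ⟨a1, a2⟩⟩
    · exact ⟨a, fun h => absurd h hc⟩
  choose t ht using hch
  have g : Good pp cl (fun X Y => l (φ (t X Y))) (fun X Y => r (φ (t X Y))) := by
    refine ⟨?_, ?_, ?_, ?_⟩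
    · intro X Y X' Y' c c' p p'
      exact (hφ _ _ (by rwa [(ht _ _ c).1, (ht _ _ c').1]) (by rwa [(ht _ _ c).2, (ht _ _ c').2])).1
    · intro X Y X' Y' c c' p p'
      exact (hφ _ _ (by rwa [(ht _ _ c).1, (ht _ _ c').1]) (by rwa [(ht _ _ c).2, (ht _ _ c').2])).2
    · intro X Y X' Y' c c' p p'
      have := (wi _ _ p p').1
      rwa [(ht _ _ c).1, (ht _ _ c').1] at this
    · intro X Y X' Y' c c' p p'
      have := (wi _ _ p p').2
      rwa [(ht _ _ c).2, (ht _ _ c').2] at this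
  have ea := ht _ _ (hlr a)
  have eb := ht _ _ (hlr b)
  have wa := wd _ _ ea.1 ea.2
  have wb := wd _ _ eb.1 eb.2
  refine h.core g (hlr a) (hlr b) ?_ ?_
  · simpa only [wa.1, wb.1] using h1
  · simpa only [wa.2, wb.2] using h2

end EPl

section plane

/-- diagonal form on `F³` -/
def ip {F : Type*} [Field F] (α β : F) (x y : Fin 3 → F) : F :=
  α * (x 0 * y 0) + β * (x 1 * y 1) + α * β * (x 2 * y 2)

/-- cross product adapted to `ip` -/
def cr {F : Type*} [Field F] (α β : F) (u v : Fin 3 → F) : Fin 3 → F :=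
  ![β * (u 1 * v 2 - u 2 * v 1), α * (u 2 * v 0 - u 0 * v 2), u 0 * v 1 - u 1 * v 0]

theorem ip_comm' {F : Type*} [Field F] (α β : F) (x y : Fin 3 → F) : ip α β x y = ip α β y x := by
  simp only [ip]; ring

theorem ip_smul_left' {F : Type*} [Field F] (α β k : F) (x y : Fin 3 → F) :
    ip α β (k • x) y = k * ip α β x y := by
  simp [ip]; ring

theorem ip_smul_right' {F : Type*} [Field F] (α β k : F) (x y : Fin 3 → F) :
    ip α β x (k • y) = k * ip α β x y := by
  simp [ip]; ring

theorem ip_add_left' {F : Type*} [Field F] (α β : F) (x x' y : Fin 3 → F) :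
    ip α β (x + x') y = ip α β x y + ip α β x' y := by
  simp [ip]; ring

theorem ip_add_right' {F : Type*} [Field F] (α β : F) (x x' y : Fin 3 → F) :
    ip α β y (x + x') = ip α β y x + ip α β y x' := by
  simp [ip]; ring

theorem ip_sub_left' {F : Type*} [Field F] (α β : F) (x x' y : Fin 3 → F) :
    ip α β (x - x') y = ip α β x y - ip α β x' y := by
  simp [ip]; ring

theorem ip_sub_right' {F : Type*} [Field F] (α β : F) (x x' y : Fin 3 → F) :
    ip α β y (x - x') = ip α β y x - ip α β y x' := by
  simp [ip]; ring

theorem ip_cr_left {F : Type*} [Field F] (α β : F) (x y : Fin 3 → F) :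
    ip α β (cr α β x y) x = 0 := by
  simp [ip, cr]; ring

theorem ip_cr_right {F : Type*} [Field F] (α β : F) (x y : Fin 3 → F) :
    ip α β (cr α β x y) y = 0 := by
  simp [ip, cr]; ring

theorem cr_cr {F : Type*} [Field F] (α β : F) (w u v : Fin 3 → F) :
    cr α β w (cr α β u v) = ip α β w v • u - ip α β w u • v := by
  ext i; fin_cases i <;> simp [ip, cr] <;> ring

/-- anisotropy -/
def An {F : Type*} [Field F] (α β : F) : Prop := ∀ x : Fin 3 → F, ip α β x x = 0 → x = 0

theorem par_of_cr {F : Type*} [Field F] {α β : F} (h : An α β) {w n : Fin 3 → F} (hn : n ≠ 0)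
    (hc : cr α β w n = 0) : ∃ k : F, w = k • n := by
  have h1 := cr_cr α β n w n
  have h0 : cr α β n 0 = 0 := by ext i; fin_cases i <;> simp [cr]
  rw [hc, h0] at h1
  have hq : ip α β n n ≠ 0 := fun e => hn (h _ e)
  refine ⟨(ip α β n n)⁻¹ * ip α β n w, ?_⟩
  rw [mul_smul, ← sub_eq_zero.mp h1.symm, smul_smul, inv_mul_cancel₀ hq, one_smul]

theorem orth_span {F : Type*} [Field F] {α β : F} (h : An α β) {x y w : Fin 3 → F}
    (hn : cr α β x y ≠ 0) (h1 : ip α β w x = 0) (h2 : ip α β w y = 0) :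
    ∃ k : F, w = k • cr α β x y := by
  apply par_of_cr h hn
  rw [cr_cr, h1, h2]; simp

theorem an_ne {F : Type*} [Field F] {α β : F} (h : An α β) : α ≠ 0 ∧ β ≠ 0 := by
  constructor
  · rintro rfl
    have := h ![1, 0, 0] (by simp [ip])
    simpa using congrFun this 0
  · rintro rfl
    have := h ![0, 1, 0] (by simp [ip])
    simpa using congrFun this 1

/-- the field has more than three elements -/
theorem an_elt {F : Type*} [Field F] {α β : F} (h : An α β) (h2 : (2 : F) ≠ 0) :
    ∃ t : F, t ≠ 0 ∧ t ≠ 1 ∧ t ≠ -1 := by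
  by_contra! hc
  have key : ∀ t : F, t ≠ 0 → t = 1 ∨ t = -1 := by
    intro t ht
    by_cases h1 : t = 1
    · exact Or.inl h1
    · exact Or.inr (hc t ht h1)
  obtain ⟨ha, hb⟩ := an_ne h
  have h3 : (3 : F) = 0 := by
    rcases key 2 h2 with e | e
    · exfalso; apply one_ne_zero (α := F); linear_combination e
    · linear_combination e
  rcases key α ha with rfl | rfl
  · rcases key β hb with rfl | rfl
    · have := h ![1, 1, 1] (by simp [ip]; linear_combination h3)
      simpa using congrFun this 0
    · have := h ![1, 0, 1] (by simp [ip])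
      simpa using congrFun this 0
  · have := h ![0, 1, 1] (by simp [ip])
    simpa using congrFun this 1

/-- perpendicular points -/
def ppr {F : Type*} [Field F] (α β : F) (X Y : Projectivization F (Fin 3 → F)) : Prop :=
  ip α β X.rep Y.rep = 0

/-- points of the same square class -/
def cls {F : Type*} [Field F] (α β : F) (X Y : Projectivization F (Fin 3 → F)) : Prop :=
  ∃ s : F, s ≠ 0 ∧ ip α β X.rep X.rep = s ^ 2 * ip α β Y.rep Y.rep

theorem rep_mk {F : Type*} [Field F] (x : Fin 3 → F) (hx : x ≠ 0) :
    ∃ k : F, k ≠ 0 ∧ (Projectivization.mk F x hx).rep = k • x := by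
  obtain ⟨a, ha⟩ := Projectivization.exists_smul_eq_mk_rep F x hx
  exact ⟨a, a.ne_zero, ha.symm⟩

theorem ppr_mk {F : Type*} [Field F] (α β : F) (x y : Fin 3 → F) (hx : x ≠ 0) (hy : y ≠ 0) :
    ppr α β (Projectivization.mk F x hx) (Projectivization.mk F y hy) ↔ ip α β x y = 0 := by
  obtain ⟨k, hk, ek⟩ := rep_mk x hx
  obtain ⟨j, hj, ej⟩ := rep_mk y hy
  rw [ppr, ek, ej, ip_smul_left', ip_smul_right']
  simp [hk, hj]

theorem cls_mk {F : Type*} [Field F] (α β : F) (x y : Fin 3 → F) (hx : x ≠ 0) (hy : y ≠ 0) :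
    cls α β (Projectivization.mk F x hx) (Projectivization.mk F y hy) ↔
      ∃ s : F, s ≠ 0 ∧ ip α β x x = s ^ 2 * ip α β y y := by
  obtain ⟨k, hk, ek⟩ := rep_mk x hx
  obtain ⟨j, hj, ej⟩ := rep_mk y hy
  rw [cls, ek, ej, ip_smul_left', ip_smul_right', ip_smul_left', ip_smul_right']
  constructor
  · rintro ⟨s, hs, e⟩
    refine ⟨s * j / k, by positivity, ?_⟩
    field_simp
    linear_combination e
  · rintro ⟨s, hs, e⟩
    refine ⟨s * k / j, by positivity, ?_⟩
    rw [e]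
    field_simp

theorem cr_ne {F : Type*} [Field F] {α β : F} (h : An α β) {x y : Fin 3 → F} (hx : x ≠ 0)
    (hy : y ≠ 0) (hne : Projectivization.mk F x hx ≠ Projectivization.mk F y hy) :
    cr α β x y ≠ 0 := by
  intro e
  obtain ⟨k, hk⟩ := par_of_cr h hy e
  exact hne ((Projectivization.mk_eq_mk_iff' F x y hx hy).2 ⟨k, hk.symm⟩)

theorem pole_vec {F : Type*} [Field F] {α β : F} (h : An α β) (x y : Fin 3 → F) (hx : x ≠ 0)
    (hy : y ≠ 0) : ∃ w, w ≠ 0 ∧ ip α β w x = 0 ∧ ip α β w y = 0 := by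
  by_cases hc : cr α β x y = 0
  · obtain ⟨k, rfl⟩ := par_of_cr h hy hc
    suffices hs : ∃ w, w ≠ 0 ∧ ip α β w y = 0 by
      obtain ⟨w, hw, e⟩ := hs
      exact ⟨w, hw, by rw [ip_smul_right', e, mul_zero], e⟩
    obtain ⟨ha, hb⟩ := an_ne h
    by_contra! hcon
    have h1 : cr α β y ![1, 0, 0] = 0 := by
      by_contra h1; exact hcon _ h1 (ip_cr_left ..)
    have h2 : cr α β y ![0, 1, 0] = 0 := by
      by_contra h1; exact hcon _ h1 (ip_cr_left ..)
    apply hy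
    have a1 := congrFun h1 1
    have a2 := congrFun h1 2
    have a3 := congrFun h2 2
    simp [cr, ha] at a1 a2 a3
    ext i; fin_cases i <;> simp [a1, a2, a3]
  · exact ⟨_, hc, ip_cr_left .., ip_cr_right ..⟩

theorem three_vec {F : Type*} [Field F] {α β : F} (h : An α β) (h2 : (2 : F) ≠ 0)
    (x k : Fin 3 → F) (hx : x ≠ 0) (hk : k ≠ 0) (hp : ip α β x k = 0) :
    ∃ n, n ≠ 0 ∧ ip α β n k = 0 ∧ ip α β n x = 0 ∧
    ∃ a b c d s t : F, b ≠ 0 ∧ d ≠ 0 ∧ a * d ≠ b * c ∧ s ≠ 0 ∧ t ≠ 0 ∧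
      a ^ 2 * ip α β x x + b ^ 2 * ip α β n n = s ^ 2 * ip α β x x ∧
      c ^ 2 * ip α β x x + d ^ 2 * ip α β n n = t ^ 2 * ip α β x x := by
  obtain ⟨n, hn, h1, h3⟩ := pole_vec h k x hk hx
  refine ⟨n, hn, h1, h3, ?_⟩
  have hqx : ip α β x x ≠ 0 := fun e => hx (h _ e)
  have hqn : ip α β n n ≠ 0 := fun e => hn (h _ e)
  have hsum : ∀ t : F, ip α β x x + t ^ 2 * ip α β n n ≠ 0 := by
    intro t e
    have : x + t • n = 0 := by
      apply h
      simp only [ip_add_left', ip_add_right', ip_smul_left', ip_smul_right', h3, ip_comm' α β x n]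
      linear_combination e
    apply hqx
    have : ip α β (x + t • n) x = 0 := by rw [this]; simp [ip]
    simpa [ip_add_left', ip_smul_left', h3] using this
  by_cases hq : ip α β x x = ip α β n n
  · obtain ⟨t, t0, t1, t2⟩ := an_elt h h2
    refine ⟨0, 1, 1 - t ^ 2, 2 * t, 1, 1 + t ^ 2, one_ne_zero, mul_ne_zero h2 t0, ?_, one_ne_zero, ?_, ?_, ?_⟩
    · intro e
      have : (1 - t) * (1 + t) = 0 := by linear_combination -e
      rcases mul_eq_zero.mp this with e | e
      · exact t1 (by linear_combination -e)
      · exact t2 (by linear_combination e)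
    · have := hsum t
      rw [← hq] at this
      intro e; apply this; linear_combination ip α β x x * e
    · rw [hq]; ring
    · rw [hq]; ring
  · refine ⟨ip α β x x - ip α β n n, 2 * ip α β x x, ip α β x x - ip α β n n, -(2 * ip α β x x),
      ip α β x x + ip α β n n, ip α β x x + ip α β n n, mul_ne_zero h2 hqx,
      neg_ne_zero.mpr (mul_ne_zero h2 hqx), ?_, ?_, ?_, ?_, ?_⟩
    · intro e
      have : (2 * 2 * ip α β x x) * (ip α β x x - ip α β n n) = 0 := by linear_combination -e
      rcases mul_eq_zero.mp this with e | e
      · exact (mul_ne_zero (mul_ne_zero h2 h2) hqx) e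
      · exact hq (by linear_combination e)
    · simpa using hsum 1
    · simpa using hsum 1
    · ring
    · ring

theorem rot_vec {F : Type*} [Field F] {α β : F} (h : An α β) (h2 : (2 : F) ≠ 0)
    (x y : Fin 3 → F) (hx : x ≠ 0) (he : ip α β x x = ip α β y y) :
    ∃ s : (Fin 3 → F) →ₗ[F] (Fin 3 → F), (∃ k : F, k ≠ 0 ∧ s x = k • y) ∧
      ∀ u v, ip α β (s u) (s v) = ip α β u v := by
  obtain ⟨z, hz, k, hk, hzk⟩ : ∃ z, x + z ≠ 0 ∧ ∃ k : F, (k = 1 ∨ k = -1) ∧ z = k • y := by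
    by_cases hxy : x + y = 0
    · refine ⟨-y, ?_, -1, Or.inr rfl, by simp⟩
      intro e
      apply hx
      have : (2 : F) • x = 0 := by
        rw [two_smul]
        calc x + x = (x + y) + (x + -y) := by abel
          _ = 0 := by rw [e, hxy, add_zero]
      exact (smul_eq_zero.mp this).resolve_left h2
    · exact ⟨y, hxy, 1, Or.inl rfl, by simp⟩
  have hzz : ip α β z z = ip α β x x := by
    rw [hzk, ip_smul_left', ip_smul_right', he]
    rcases hk with rfl | rfl <;> ring
  set w := x + z with hw
  have hqw : ip α β w w ≠ 0 := fun e => hz (h _ e)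
  let fl : (Fin 3 → F) →ₗ[F] F :=
    { toFun := fun v => ip α β v w
      map_add' := fun a b => ip_add_left' ..
      map_smul' := fun a b => ip_smul_left' .. }
  refine ⟨(2 * (ip α β w w)⁻¹) • fl.smulRight w - LinearMap.id, ⟨k, ?_, ?_⟩, ?_⟩
  · rcases hk with rfl | rfl <;> simp
  · rw [← hzk]
    have e : 2 * ip α β x w = ip α β w w := by
      simp only [hw, ip_add_left', ip_add_right', hzz, ip_comm' α β z x]; ring
    simp only [LinearMap.sub_apply, LinearMap.smul_apply, LinearMap.smulRight_apply, LinearMap.id_apply]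
    change (2 * (ip α β w w)⁻¹) • ip α β x w • w - x = z
    rw [smul_smul]
    have : 2 * (ip α β w w)⁻¹ * ip α β x w = 1 := by
      rw [mul_comm 2, mul_assoc, e, inv_mul_cancel₀ hqw]
    rw [this, one_smul, hw]; abel
  · intro u v
    simp only [LinearMap.sub_apply, LinearMap.smul_apply, LinearMap.smulRight_apply, LinearMap.id_apply]
    change ip α β ((2 * (ip α β w w)⁻¹) • ip α β u w • w - u) ((2 * (ip α β w w)⁻¹) • ip α β v w • w - v) = _
    simp only [ip_sub_left', ip_sub_right', ip_smul_left', ip_smul_right', ip_comm' α β w v]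
    field_simp
    ring

theorem harm_vec {F : Type*} [Field F] {α β : F} (h : An α β) (h2 : (2 : F) ≠ 0)
    (x c : Fin 3 → F) (hx : x ≠ 0) (hc : c ≠ 0) (hcr : cr α β x c ≠ 0) (hp : ip α β x c ≠ 0) :
    ∃ o c' k x'' : Fin 3 → F, o ≠ 0 ∧ c' ≠ 0 ∧ k ≠ 0 ∧ x'' ≠ 0 ∧ ip α β o x = 0 ∧ ip α β o c = 0 ∧
      ip α β c' o = 0 ∧ ip α β c' c = 0 ∧ ip α β k o = 0 ∧ ip α β k x = 0 ∧
      (∀ j : F, x'' ≠ j • x) ∧ (∃ s : F, s ≠ 0 ∧ ip α β x'' x'' = s ^ 2 * ip α β x x) ∧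
      ip α β x'' o = 0 ∧ ∀ A, ip α β A k = 0 → (∀ j : F, A ≠ j • o) → (∀ j : F, A ≠ j • x) →
      ∃ d e : Fin 3 → F, d ≠ 0 ∧ e ≠ 0 ∧ ip α β d c = 0 ∧ ip α β e c' = 0 ∧
        (∃ p q : F, d = p • A + q • c) ∧ (∃ p q : F, e = p • A + q • c') ∧
        (∃ p q : F, x'' = p • d + q • e) := by
  have hqx : ip α β x x ≠ 0 := fun e => hx (h _ e)
  have hqc : ip α β c c ≠ 0 := fun e => hc (h _ e)
  have hqo : ip α β (cr α β x c) (cr α β x c) ≠ 0 := fun e => hcr (h _ e)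
  set o := cr α β x c with ho
  have hox : ip α β o x = 0 := ip_cr_left ..
  have hoc : ip α β o c = 0 := ip_cr_right ..
  have hxo : ip α β x o = 0 := by rw [ip_comm']; exact hox
  have hco : ip α β c o = 0 := by rw [ip_comm']; exact hoc
  have hk : cr α β o x ≠ 0 := by
    intro e
    obtain ⟨j, hj⟩ := par_of_cr h hx e
    apply hqo
    nth_rewrite 1 [hj]
    rw [ip_smul_left', hxo, mul_zero]
  set c' := ip α β c c • x - ip α β x c • c with hc'
  set c0 := ip α β x c • c with hc0
  have e0 : c0 + c' = ip α β c c • x := by rw [hc']; abel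
  have hc'c : ip α β c' c = 0 := by
    simp only [hc', hc0, ip_sub_left', ip_smul_left']; ring
  have hc'o : ip α β c' o = 0 := by
    simp only [hc', hc0, ip_sub_left', ip_smul_left', hxo, hco]; ring
  have hc0o : ip α β c0 o = 0 := by
    simp only [hc0, ip_smul_left', hco]; ring
  have hc'c0 : ip α β c' c0 = 0 := by rw [hc0, ip_smul_right', hc'c, mul_zero]
  have hc0c' : ip α β c0 c' = 0 := by rw [ip_comm', hc'c0]
  have hc'0 : c' ≠ 0 := by
    intro e
    apply hcr
    have hx' : x = ((ip α β c c)⁻¹ * ip α β x c) • c := by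
      rw [mul_smul, ← sub_eq_zero.mp e, smul_smul, inv_mul_cancel₀ hqc, one_smul]
    rw [ho, hx']
    ext i; fin_cases i <;> simp [cr] <;> ring_nf <;> simp
  have hc00 : c0 ≠ 0 := smul_ne_zero hp hc
  have hqc' : ip α β c' c' ≠ 0 := fun e => hc'0 (h _ e)
  have hqc0 : ip α β c0 c0 ≠ 0 := fun e => hc00 (h _ e)
  have hxe : x = (ip α β c c)⁻¹ • (c0 + c') := by
    rw [e0, smul_smul, inv_mul_cancel₀ hqc, one_smul]
  have hnj : ∀ j : F, c0 - c' ≠ j • x := by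
    intro j e
    rw [hxe, smul_smul] at e
    set i := j * (ip α β c c)⁻¹
    have a1 : ip α β (c0 - c') c' = ip α β (i • (c0 + c')) c' := by rw [e]
    have a2 : ip α β (c0 - c') c0 = ip α β (i • (c0 + c')) c0 := by rw [e]
    simp only [ip_sub_left', ip_smul_left', ip_add_left', hc'c0, hc0c'] at a1 a2
    have b1 : i = -1 := by
      apply mul_right_cancel₀ hqc'; linear_combination -a1
    have b2 : i = 1 := by
      apply mul_right_cancel₀ hqc0; linear_combination -a2
    apply h2; linear_combination b1 - b2
  refine ⟨o, c', cr α β o x, c0 - c', hcr, hc'0, hk, ?_, hox, hoc, hc'o, hc'c, ip_cr_left .., ip_cr_right .., hnj, ?_, ?_, ?_⟩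
  · intro e; exact hnj 0 (by rw [e, zero_smul])
  · refine ⟨ip α β c c, hqc, ?_⟩
    have : ip α β (c0 + c') (c0 + c') = ip α β c c ^ 2 * ip α β x x := by
      rw [e0, ip_smul_left', ip_smul_right']; ring
    rw [← this]
    simp only [ip_sub_left', ip_sub_right', ip_add_left', ip_add_right', hc'c0, hc0c']; ring
  · rw [ip_sub_left', hc0o, hc'o, sub_zero]
  · intro A hA hAo hAx
    obtain ⟨p, r, hpr⟩ : ∃ p r : F, A = p • o + r • x := by
      have e1 : ip α β (cr α β o x) A = 0 := by rw [ip_comm']; exact hA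
      -- decompose `A` along the orthogonal basis
      set B := A - (ip α β A o / ip α β o o) • o - (ip α β A x / ip α β x x) • x with hB
      have b1 : ip α β B o = 0 := by
        simp only [hB, ip_sub_left', ip_smul_left', hxo]; field_simp; ring
      have b2 : ip α β B x = 0 := by
        simp only [hB, ip_sub_left', ip_smul_left', hox]; field_simp; ring
      obtain ⟨j, hj⟩ := orth_span h hk b1 b2
      have b3 : ip α β B (cr α β o x) = 0 := by
        simp only [hB, ip_sub_left', ip_smul_left', hA, ip_comm' α β o, ip_comm' α β x,
          ip_cr_left α β o x, ip_cr_right α β o x]; ring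
      have b4 : B = 0 := by
        apply h
        nth_rewrite 2 [hj]
        rw [ip_smul_right', b3, mul_zero]
      refine ⟨ip α β A o / ip α β o o, ip α β A x / ip α β x x, ?_⟩
      have : A = B + (ip α β A o / ip α β o o) • o + (ip α β A x / ip α β x x) • x := by
        rw [hB]; abel
      rw [b4, zero_add] at this
      exact this
    have hp0 : p ≠ 0 := by
      rintro rfl; exact hAx r (by rw [hpr]; simp)
    have hr0 : r ≠ 0 := by
      rintro rfl; exact hAo p (by rw [hpr]; simp)
    set t := r * (ip α β c c)⁻¹ with ht
    have ht0 : t ≠ 0 := mul_ne_zero hr0 (inv_ne_zero hqc)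
    have hA2 : A = p • o + t • (c0 + c') := by
      rw [hpr, e0, smul_smul, ht, mul_assoc, inv_mul_cancel₀ hqc, mul_one]
    refine ⟨p • o + t • c', p • o + t • c0, ?_, ?_, ?_, ?_, ⟨1, -t * ip α β x c, ?_⟩, ⟨1, -t, ?_⟩,
      ⟨-t⁻¹, t⁻¹, ?_⟩⟩
    · intro e
      have : ip α β (p • o + t • c') o = 0 := by rw [e]; simp [ip]
      simp [ip_add_left', ip_smul_left', hc'o, hp0, hqo] at this
    · intro e
      have : ip α β (p • o + t • c0) o = 0 := by rw [e]; simp [ip]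
      simp [ip_add_left', ip_smul_left', hc0o, hp0, hqo] at this
    · simp [ip_add_left', ip_smul_left', hoc, hc'c]
    · simp [ip_add_left', ip_smul_left', hc0c', ip_comm' α β o c', hc'o]
    · have : (-t * ip α β x c) • c = (-t) • c0 := by rw [mul_smul]
      rw [hA2, this]; module
    · rw [hA2]; module
    · simp only [smul_add, smul_smul, neg_smul, neg_mul, inv_mul_cancel₀ ht0]; module

theorem plane_epl {F : Type*} [Field F] {α β : F} (h : An α β) (h2 : (2 : F) ≠ 0) :
    EPl (ppr α β) (cls α β) where
  sym := fun {X Y} hp => by rw [ppr, ip_comm']; exact hp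
  irr := fun X hp => X.rep_nonzero (h _ hp)
  pole := fun X Y => by
    induction X using Projectivization.ind with | h x hx
    induction Y using Projectivization.ind with | h y hy
    obtain ⟨w, hw, e1, e2⟩ := pole_vec h x y hx hy
    exact ⟨Projectivization.mk F w hw, (ppr_mk ..).2 e1, (ppr_mk ..).2 e2⟩
  uniq := fun {X Y W W'} hne p1 p2 p3 p4 => by
    induction X using Projectivization.ind with | h x hx
    induction Y using Projectivization.ind with | h y hy
    induction W using Projectivization.ind with | h w hw
    induction W' using Projectivization.ind with | h w' hw'
    rw [ppr_mk] at p1 p2 p3 p4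
    have hn := cr_ne h hx hy hne
    obtain ⟨k, e⟩ := orth_span h hn p1 p2
    obtain ⟨k', e'⟩ := orth_span h hn p3 p4
    rw [(Projectivization.mk_eq_mk_iff' F w _ hw hn).2 ⟨k, e.symm⟩,
      (Projectivization.mk_eq_mk_iff' F w' _ hw' hn).2 ⟨k', e'.symm⟩]
  crefl := fun X => ⟨1, one_ne_zero, by simp⟩
  csym := fun {X Y} ⟨s, hs, e⟩ => ⟨s⁻¹, inv_ne_zero hs, by rw [e]; field_simp⟩
  ctrans := fun {X Y Z} ⟨s, hs, e⟩ ⟨t, ht, e'⟩ => ⟨s * t, mul_ne_zero hs ht, by rw [e, e']; ring⟩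
  rot := fun {X Y} hc => by
    induction X using Projectivization.ind with | h x hx
    induction Y using Projectivization.ind with | h y hy
    rw [cls_mk] at hc
    obtain ⟨t, ht, e⟩ := hc
    obtain ⟨s, ⟨k, hk, e1⟩, e2⟩ := rot_vec h h2 x (t • y) hx
      (by rw [ip_smul_left', ip_smul_right', e]; ring)
    have hinj : Function.Injective s := by
      rw [← LinearMap.ker_eq_bot, LinearMap.ker_eq_bot']
      intro v hv
      apply h
      rw [← e2, hv]; simp [ip]
    refine ⟨Projectivization.map s hinj, ?_, ?_, ?_⟩
    · rw [Projectivization.map_mk, Projectivization.mk_eq_mk_iff']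
      exact ⟨k * t, by rw [e1, smul_smul]⟩
    · intro U W hp
      induction U using Projectivization.ind with | h u hu
      induction W using Projectivization.ind with | h w hw
      rw [Projectivization.map_mk, Projectivization.map_mk]
      rw [ppr_mk] at hp ⊢
      rw [e2, hp]
    · intro U
      induction U using Projectivization.ind with | h u hu
      rw [Projectivization.map_mk, cls_mk]
      exact ⟨1, one_ne_zero, by rw [e2]; simp⟩
  three := fun {X K} hp => by
    induction X using Projectivization.ind with | h x hx
    induction K using Projectivization.ind with | h k hk
    rw [ppr_mk] at hp
    obtain ⟨n, hn, n1, n2, a, b, c, d, s, t, hb, hd, hne, hs, ht, e1, e2⟩ := three_vec h h2 x k hx hk hp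
    have hqx : ip α β x x ≠ 0 := fun e => hx (h _ e)
    have hqn : ip α β n n ≠ 0 := fun e => hn (h _ e)
    have n3 : ip α β x n = 0 := by rw [ip_comm', n2]
    have ind : ∀ a b : F, a • x + b • n = 0 → a = 0 ∧ b = 0 := by
      intro a b e
      have a1 : ip α β (a • x + b • n) x = 0 := by rw [e]; simp [ip]
      have a2 : ip α β (a • x + b • n) n = 0 := by rw [e]; simp [ip]
      simp [ip_add_left', ip_smul_left', n2, n3, hqx, hqn] at a1 a2
      exact ⟨a1, a2⟩
    have h1 : a • x + b • n ≠ 0 := fun e => hb (ind _ _ e).2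
    have h3 : c • x + d • n ≠ 0 := fun e => hd (ind _ _ e).2
    refine ⟨Projectivization.mk F _ h1, Projectivization.mk F _ h3, ?_, ?_, ?_, ?_, ?_, ?_, ?_⟩
    · rw [Ne, Projectivization.mk_eq_mk_iff']
      rintro ⟨j, hj⟩
      exact hb (ind (a - j) b (by rw [sub_smul, hj]; abel)).2
    · rw [Ne, Projectivization.mk_eq_mk_iff']
      rintro ⟨j, hj⟩
      exact hd (ind (c - j) d (by rw [sub_smul, hj]; abel)).2
    · rw [Ne, Projectivization.mk_eq_mk_iff']
      rintro ⟨j, hj⟩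
      obtain ⟨u, v⟩ := ind (j * c - a) (j * d - b) (by
        rw [← sub_eq_zero] at hj; rw [← hj]; module)
      apply hne
      linear_combination c * v - d * u
    · rw [ppr_mk]; simp [ip_add_left', ip_smul_left', n1, hp]
    · rw [ppr_mk]; simp [ip_add_left', ip_smul_left', n1, hp]
    · rw [cls_mk]
      refine ⟨s, hs, ?_⟩
      rw [← e1]
      simp only [ip_add_left', ip_add_right', ip_smul_left', ip_smul_right', n2, n3]; ring
    · rw [cls_mk]
      refine ⟨t, ht, ?_⟩
      rw [← e2]
      simp only [ip_add_left', ip_add_right', ip_smul_left', ip_smul_right', n2, n3]; ring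
  harm := fun {X C} hne hnp => by
    induction X using Projectivization.ind with | h x hx
    induction C using Projectivization.ind with | h c hc
    rw [ppr_mk] at hnp
    obtain ⟨o, c', k, x'', ho, hc', hk, hx'', a1, a2, a3, a4, a5, a6, a7, a8, a9, H⟩ :=
      harm_vec h h2 x c hx hc (cr_ne h hx hc hne) hnp
    refine ⟨Projectivization.mk F o ho, Projectivization.mk F c' hc', Projectivization.mk F k hk,
      Projectivization.mk F x'' hx'', (ppr_mk ..).2 a1, (ppr_mk ..).2 a2, (ppr_mk ..).2 a3,
      (ppr_mk ..).2 a4, (ppr_mk ..).2 a5, (ppr_mk ..).2 a6, ?_, (cls_mk ..).2 a8, (ppr_mk ..).2 a9, ?_⟩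
    · rw [Ne, Projectivization.mk_eq_mk_iff']
      rintro ⟨j, hj⟩
      exact a7 j hj.symm
    · intro A hA hAO hAX
      induction A using Projectivization.ind with | h a ha
      rw [ppr_mk] at hA
      rw [Ne, Projectivization.mk_eq_mk_iff'] at hAO hAX
      obtain ⟨d, e, hd, he, b1, b2, ⟨p1, q1, b3⟩, ⟨p2, q2, b4⟩, ⟨p3, q3, b5⟩⟩ := H a hA
        (fun j hj => hAO ⟨j, hj.symm⟩) (fun j hj => hAX ⟨j, hj.symm⟩)
      obtain ⟨k1, hk1, u1, v1⟩ := pole_vec h a c ha hc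
      obtain ⟨k2, hk2, u2, v2⟩ := pole_vec h a c' ha hc'
      obtain ⟨k3, hk3, u3, v3⟩ := pole_vec h d e hd he
      refine ⟨Projectivization.mk F d hd, Projectivization.mk F e he, Projectivization.mk F k1 hk1,
        Projectivization.mk F k2 hk2, Projectivization.mk F k3 hk3, (ppr_mk ..).2 b1, ?_, ?_, ?_,
        (ppr_mk ..).2 b2, (ppr_mk ..).2 u2, (ppr_mk ..).2 v2, ?_, (ppr_mk ..).2 u3, (ppr_mk ..).2 v3, ?_⟩
      · rw [ppr_mk, ip_comm', b3]; simp [ip_add_right', ip_smul_right', u1, v1]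
      · rw [ppr_mk, ip_comm']; exact u1
      · rw [ppr_mk, ip_comm']; exact v1
      · rw [ppr_mk, b4]; simp [ip_add_right', ip_smul_right', u2, v2]
      · rw [ppr_mk, b5]; simp [ip_add_right', ip_smul_right', u3, v3]

end plane

section coord

/-- Plücker coordinates -/
def pk {F : Type*} [Field F] (u v : Fin 4 → F) (i j : Fin 4) : F := u i * v j - u j * v i

/-- left image -/
def xl {F : Type*} [Field F] (α β : F) (u v : Fin 4 → F) : Fin 3 → F :=
  ![pk u v 0 1 + β * pk u v 2 3, pk u v 0 2 + α * pk u v 3 1, pk u v 0 3 + pk u v 1 2]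

/-- right image -/
def yl {F : Type*} [Field F] (α β : F) (u v : Fin 4 → F) : Fin 3 → F :=
  ![pk u v 0 1 - β * pk u v 2 3, pk u v 0 2 - α * pk u v 3 1, pk u v 0 3 - pk u v 1 2]

theorem ip_xl_yl {F : Type*} [Field F] (α β : F) (u v : Fin 4 → F) :
    ip α β (xl α β u v) (xl α β u v) = ip α β (yl α β u v) (yl α β u v) := by
  simp [ip, xl, yl, pk]; ring

theorem pk_prop {F : Type*} [Field F] {α β : F} (h : An α β) (h2 : (2 : F) ≠ 0) {k : F}
    {u v u' v' : Fin 4 → F} (hx : xl α β u v = k • xl α β u' v')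
    (hy : yl α β u v = k • yl α β u' v') (i j : Fin 4) : pk u v i j = k * pk u' v' i j := by
  obtain ⟨ha, hb⟩ := an_ne h
  have x0 := congrFun hx 0
  have x1 := congrFun hx 1
  have x2 := congrFun hx 2
  have y0 := congrFun hy 0
  have y1 := congrFun hy 1
  have y2 := congrFun hy 2
  simp [xl, yl] at x0 x1 x2 y0 y1 y2
  have e01 : pk u v 0 1 = k * pk u' v' 0 1 := by
    apply mul_left_cancel₀ h2; linear_combination x0 + y0
  have e23 : pk u v 2 3 = k * pk u' v' 2 3 := by
    apply mul_left_cancel₀ (mul_ne_zero h2 hb); linear_combination x0 - y0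
  have e02 : pk u v 0 2 = k * pk u' v' 0 2 := by
    apply mul_left_cancel₀ h2; linear_combination x1 + y1
  have e31 : pk u v 3 1 = k * pk u' v' 3 1 := by
    apply mul_left_cancel₀ (mul_ne_zero h2 ha); linear_combination x1 - y1
  have e03 : pk u v 0 3 = k * pk u' v' 0 3 := by
    apply mul_left_cancel₀ h2; linear_combination x2 + y2
  have e12 : pk u v 1 2 = k * pk u' v' 1 2 := by
    apply mul_left_cancel₀ h2; linear_combination x2 - y2
  have hs : ∀ (u v : Fin 4 → F) i j, pk u v i j = - pk u v j i := by
    intro u v i j; simp only [pk]; ring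
  have hd : ∀ (u v : Fin 4 → F) i, pk u v i i = 0 := by
    intro u v i; simp only [pk]; ring
  have f : ∀ i j, pk u v i j = k * pk u' v' i j → pk u v j i = k * pk u' v' j i := by
    intro i j e; rw [hs u v, hs u' v', e]; ring
  fin_cases i <;> fin_cases j <;>
    first
    | (simp only [hd, mul_zero]; done)
    | assumption
    | (apply f; assumption)

theorem xl_ne {F : Type*} [Field F] {α β : F} (h : An α β) (h2 : (2 : F) ≠ 0)
    {u v : Fin 4 → F} {i j : Fin 4} (hp : pk u v i j ≠ 0) : xl α β u v ≠ 0 ∧ yl α β u v ≠ 0 := by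
  have key : ¬ (xl α β u v = 0 ∧ yl α β u v = 0) := by
    rintro ⟨h3, h4⟩
    apply hp
    have := pk_prop h h2 (k := 0) (u := u) (v := v) (u' := u) (v' := v) (by simp [h3]) (by simp [h4]) i j
    simpa using this
  have e := ip_xl_yl α β u v
  constructor
  · intro h3
    refine key ⟨h3, h _ ?_⟩
    rw [← e, h3]; simp [ip]
  · intro h3
    refine key ⟨h _ ?_, h3⟩
    rw [e, h3]; simp [ip]

theorem pk_ne {F : Type*} [Field F] {u v : Fin 4 → F}
    (hi : ∀ s t : F, s • u + t • v = 0 → s = 0 ∧ t = 0) : ∃ i j, pk u v i j ≠ 0 := by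
  by_contra! hc
  have hu : u ≠ 0 := by
    rintro rfl
    exact one_ne_zero (hi 1 0 (by simp)).1
  obtain ⟨i, hi'⟩ := Function.ne_iff.mp hu
  apply hi'
  have : v i • u + (-u i) • v = 0 := by
    ext j
    have := hc i j
    simp only [pk] at this
    simp; linear_combination -this
  simpa using (hi _ _ this).2

theorem ind_of_pk {F : Type*} [Field F] {u v : Fin 4 → F} {i j : Fin 4} (hp : pk u v i j ≠ 0)
    (s t : F) (e : s • u + t • v = 0) : s = 0 ∧ t = 0 := by
  have ei := congrFun e i
  have ej := congrFun e j
  simp at ei ej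
  constructor
  · apply (mul_eq_zero.mp (?_ : s * pk u v i j = 0)).resolve_right hp
    simp only [pk]; linear_combination v j * ei - v i * ej
  · apply (mul_eq_zero.mp (?_ : t * pk u v i j = 0)).resolve_right hp
    simp only [pk]; linear_combination u i * ej - u j * ei

theorem xl_comb {F : Type*} [Field F] (α β : F) (u v : Fin 4 → F) (a b c d : F) :
    xl α β (a • u + b • v) (c • u + d • v) = (a * d - b * c) • xl α β u v ∧
    yl α β (a • u + b • v) (c • u + d • v) = (a * d - b * c) • yl α β u v := by
  constructor <;> (ext i; fin_cases i <;> simp [xl, yl, pk] <;> ring)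

theorem surj_vec {F : Type*} [Field F] {α β : F} (h : An α β) (h2 : (2 : F) ≠ 0)
    (x y : Fin 3 → F) (hx : x ≠ 0) (he : ip α β x x = ip α β y y) :
    ∃ u v : Fin 4 → F, ∃ k : F, k ≠ 0 ∧ xl α β u v = k • x ∧ yl α β u v = k • y := by
  obtain ⟨ha, hb⟩ := an_ne h
  obtain ⟨P01, P02, P03, P12, P31, P23, k, hk, hP, a1, a2, a3, b1, b2, b3⟩ :
    ∃ P01 P02 P03 P12 P31 P23 k : F, k ≠ 0 ∧ P01 * P23 + P02 * P31 + P03 * P12 = 0 ∧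
      P01 + β * P23 = k * x 0 ∧ P02 + α * P31 = k * x 1 ∧ P03 + P12 = k * x 2 ∧
      P01 - β * P23 = k * y 0 ∧ P02 - α * P31 = k * y 1 ∧ P03 - P12 = k * y 2 := by
    refine ⟨α * β * (x 0 + y 0), α * β * (x 1 + y 1), α * β * (x 2 + y 2), α * β * (x 2 - y 2),
      β * (x 1 - y 1), α * (x 0 - y 0), 2 * α * β, by positivity, ?_, ?_, ?_, ?_, ?_, ?_, ?_⟩
    · simp only [ip] at he
      linear_combination (α * β) * he
    all_goals ring
  have key : ∀ (c : F) (u v : Fin 4 → F), c ≠ 0 →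
      xl α β u v = c • ![P01 + β * P23, P02 + α * P31, P03 + P12] →
      yl α β u v = c • ![P01 - β * P23, P02 - α * P31, P03 - P12] →
      ∃ u v : Fin 4 → F, ∃ k : F, k ≠ 0 ∧ xl α β u v = k • x ∧ yl α β u v = k • y := by
    intro c u v hc e1 e2
    refine ⟨u, v, c * k, mul_ne_zero hc hk, ?_, ?_⟩
    · rw [e1, a1, a2, a3, mul_smul]; congr 1; ext i; fin_cases i <;> simp
    · rw [e2, b1, b2, b3, mul_smul]; congr 1; ext i; fin_cases i <;> simp
  have hne : P01 ≠ 0 ∨ P02 ≠ 0 ∨ P03 ≠ 0 ∨ P12 ≠ 0 ∨ P31 ≠ 0 ∨ P23 ≠ 0 := by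
    by_contra! hc
    obtain ⟨rfl, rfl, rfl, rfl, rfl, rfl⟩ := hc
    simp [hk] at a1 a2 a3
    apply hx
    ext i; fin_cases i <;> simp [a1, a2, a3]
  rcases hne with hn | hn | hn | hn | hn | hn
  · apply key P01 ![0, P01, P02, P03] ![-P01, 0, P12, -P31] hn <;>
    (ext i; fin_cases i <;> simp [xl, yl, pk] <;>
      first
      | ring1
      | linear_combination hP
      | linear_combination -hP
      | linear_combination β * hP
      | linear_combination -β * hP
      | linear_combination α * hP
      | linear_combination -α * hP)
  · apply key P02 ![0, P01, P02, P03] ![-P02, -P12, 0, P23] hn <;>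
    (ext i; fin_cases i <;> simp [xl, yl, pk] <;>
      first
      | ring1
      | linear_combination hP
      | linear_combination -hP
      | linear_combination β * hP
      | linear_combination -β * hP
      | linear_combination α * hP
      | linear_combination -α * hP)
  · apply key P03 ![0, P01, P02, P03] ![-P03, P31, -P23, 0] hn <;>
    (ext i; fin_cases i <;> simp [xl, yl, pk] <;>
      first
      | ring1
      | linear_combination hP
      | linear_combination -hP
      | linear_combination β * hP
      | linear_combination -β * hP
      | linear_combination α * hP
      | linear_combination -α * hP)
  · apply key P12 ![-P01, 0, P12, -P31] ![-P02, -P12, 0, P23] hn <;>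
    (ext i; fin_cases i <;> simp [xl, yl, pk] <;>
      first
      | ring1
      | linear_combination hP
      | linear_combination -hP
      | linear_combination β * hP
      | linear_combination -β * hP
      | linear_combination α * hP
      | linear_combination -α * hP)
  · apply key P31 ![-P03, P31, -P23, 0] ![-P01, 0, P12, -P31] hn <;>
    (ext i; fin_cases i <;> simp [xl, yl, pk] <;>
      first
      | ring1
      | linear_combination hP
      | linear_combination -hP
      | linear_combination β * hP
      | linear_combination -β * hP
      | linear_combination α * hP
      | linear_combination -α * hP)
  · apply key P23 ![-P02, -P12, 0, P23] ![-P03, P31, -P23, 0] hn <;>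
    (ext i; fin_cases i <;> simp [xl, yl, pk] <;>
      first
      | ring1
      | linear_combination hP
      | linear_combination -hP
      | linear_combination β * hP
      | linear_combination -β * hP
      | linear_combination α * hP
      | linear_combination -α * hP)

theorem det4 {F : Type*} [Field F] (α β : F) (u v u' v' : Fin 4 → F) :
    2 * α * β * (Matrix.of ![u, v, u', v']).det =
      ip α β (xl α β u v) (xl α β u' v') - ip α β (yl α β u v) (yl α β u' v') := by
  simp [Matrix.det_succ_row_zero, Fin.sum_univ_succ, Fin.succAbove, ip, xl, yl, pk]
  ring

/-- `u, v` is a basis of the plane `a` -/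
def IsB {F V : Type*} [Field F] [AddCommGroup V] [Module F V] (a : Submodule F V) (u v : V) : Prop :=
  u ∈ a ∧ v ∈ a ∧ (∀ w ∈ a, ∃ s t : F, w = s • u + t • v) ∧
    ∀ s t : F, s • u + t • v = 0 → s = 0 ∧ t = 0

theorem exB {F V : Type*} [Field F] [AddCommGroup V] [Module F V] (a : Submodule F V)
    (h : Module.finrank F a = 2) : ∃ u v, IsB a u v := by
  have : Module.Finite F a := Module.finite_of_finrank_pos (by omega)
  let b := Module.finBasisOfFinrankEq F a h
  refine ⟨b 0, b 1, (b 0).2, (b 1).2, ?_, ?_⟩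
  · intro w hw
    have := b.sum_repr ⟨w, hw⟩
    rw [Fin.sum_univ_two] at this
    exact ⟨_, _, by simpa using (congrArg Subtype.val this).symm⟩
  · intro s t e
    have hl := b.linearIndependent
    rw [Fintype.linearIndependent_iff] at hl
    have := hl ![s, t] (by
      rw [Fin.sum_univ_two]; apply Subtype.ext; simpa using e)
    exact ⟨this 0, this 1⟩

theorem meet_iff {F V : Type*} [Field F] [AddCommGroup V] [Module F V] (e : V ≃ₗ[F] (Fin 4 → F))
    {a b : Submodule F V} {u v u' v' : V} (ha : IsB a u v) (hb : IsB b u' v') :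
    a ⊓ b ≠ ⊥ ↔ (Matrix.of ![e u, e v, e u', e v']).det = 0 := by
  rw [← Matrix.exists_vecMul_eq_zero_iff, Submodule.ne_bot_iff]
  obtain ⟨ua, va, sa, ia⟩ := ha
  obtain ⟨ub, vb, sb, ib⟩ := hb
  have hv : ∀ z : Fin 4 → F, Matrix.vecMul z (Matrix.of ![e u, e v, e u', e v']) =
      e (z 0 • u + z 1 • v + z 2 • u' + z 3 • v') := by
    intro z
    rw [Matrix.vecMul_eq_sum]
    simp [Fin.sum_univ_four]
    rfl
  constructor
  · rintro ⟨w, hw, hw0⟩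
    obtain ⟨s, t, h1⟩ := sa w hw.1
    obtain ⟨s', t', h2⟩ := sb w hw.2
    refine ⟨![s, t, -s', -t'], ?_, ?_⟩
    · intro h0
      apply hw0
      have a0 := congrFun h0 0
      have a1 := congrFun h0 1
      simp at a0 a1
      rw [h1, a0, a1]; simp
    · rw [hv]
      have : s • u + t • v + (-s') • u' + (-t') • v' = 0 := by
        rw [← h1]; rw [h2]; module
      simpa using congrArg e this
  · rintro ⟨z, hz, h0⟩
    rw [hv] at h0
    have h1 : z 0 • u + z 1 • v + z 2 • u' + z 3 • v' = 0 := by apply e.injective; rw [h0, map_zero]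
    have h2 : z 0 • u + z 1 • v = (-z 2) • u' + (-z 3) • v' := by
      rw [← sub_eq_zero, ← h1]; module
    refine ⟨z 0 • u + z 1 • v, ⟨a.add_mem (a.smul_mem _ ua) (a.smul_mem _ va), ?_⟩, ?_⟩
    · rw [h2]; exact b.add_mem (b.smul_mem _ ub) (b.smul_mem _ vb)
    · intro h3
      obtain ⟨c0, c1⟩ := ia _ _ h3
      obtain ⟨c2, c3⟩ := ib _ _ (h2.symm.trans h3)
      apply hz
      have c2' := neg_eq_zero.mp c2
      have c3' := neg_eq_zero.mp c3
      ext i; fin_cases i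
      exacts [c0, c1, c2', c3']

theorem perp_iff {F V : Type*} [Field F] [AddCommGroup V] [Module F V] (B : LinearMap.BilinForm F V)
    {a b : Submodule F V} {u v u' v' : V} (ha : IsB a u v) (hb : IsB b u' v') :
    a ⊓ B.orthogonal b ≠ ⊥ ↔ B u' u * B v' v - B v' u * B u' v = 0 := by
  have hd : B u' u * B v' v - B v' u * B u' v =
      (!![B u' u, B v' u; B u' v, B v' v]).det := by rw [Matrix.det_fin_two_of]
  rw [hd, ← Matrix.exists_vecMul_eq_zero_iff, Submodule.ne_bot_iff]
  obtain ⟨ua, va, sa, ia⟩ := ha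
  obtain ⟨ub, vb, sb, ib⟩ := hb
  have hv : ∀ s t : F, Matrix.vecMul ![s, t] !![B u' u, B v' u; B u' v, B v' v] =
      ![B u' (s • u + t • v), B v' (s • u + t • v)] := by
    intro s t
    ext i; fin_cases i <;> simp [Matrix.vecMul, dotProduct]
  constructor
  · rintro ⟨w, hw, hw0⟩
    obtain ⟨s, t, h1⟩ := sa w hw.1
    refine ⟨![s, t], ?_, ?_⟩
    · intro h0
      apply hw0
      have a0 := congrFun h0 0
      have a1 := congrFun h0 1
      simp at a0 a1
      rw [h1, a0, a1]; simp
    · have h2 := LinearMap.BilinForm.mem_orthogonal_iff.mp hw.2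
      rw [hv, ← h1, h2 _ ub, h2 _ vb]; ext i; fin_cases i <;> rfl
  · rintro ⟨z, hz, h0⟩
    have hzz : z = ![z 0, z 1] := by ext i; fin_cases i <;> rfl
    rw [hzz, hv] at h0
    have c0 := congrFun h0 0
    have c1 := congrFun h0 1
    refine ⟨z 0 • u + z 1 • v, ⟨a.add_mem (a.smul_mem _ ua) (a.smul_mem _ va), ?_⟩, ?_⟩
    · change _ ∈ B.orthogonal b
      rw [LinearMap.BilinForm.mem_orthogonal_iff]
      intro w hw
      obtain ⟨s, t, rfl⟩ := sb w hw
      change B _ _ = 0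
      have key : ∀ w, B (s • u' + t • v') w = s * B u' w + t * B v' w := by intro w; simp
      have c0' : B u' (z 0 • u + z 1 • v) = 0 := c0
      have c1' : B v' (z 0 • u + z 1 • v) = 0 := c1
      rw [key, c0', c1']; simp
    · intro h3
      obtain ⟨c0, c1⟩ := ia _ _ h3
      apply hz
      rw [hzz, c0, c1]; ext i; fin_cases i <;> rfl

/-- the coordinates of `B` -/
def Coo {F V : Type*} [Field F] [AddCommGroup V] [Module F V] (B : LinearMap.BilinForm F V)
    (e : V ≃ₗ[F] (Fin 4 → F)) (c α β : F) : Prop := ∀ u v, B u v =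
      c * (e u 0 * e v 0 + α * (e u 1 * e v 1) + β * (e u 2 * e v 2) + α * β * (e u 3 * e v 3))

theorem ortho_iff {F V : Type*} [Field F] [AddCommGroup V] [Module F V] {B : LinearMap.BilinForm F V}
    {e : V ≃ₗ[F] (Fin 4 → F)} {c α β : F} (hB : Coo B e c α β) (hc : c ≠ 0) (h : An α β)
    (h2 : (2 : F) ≠ 0)
    {a b : Submodule F V} {u v u' v' : V} (ha : IsB a u v) (hb : IsB b u' v') :
    OrthoMeet B a b ↔ ip α β (xl α β (e u) (e v)) (xl α β (e u') (e v')) = 0 ∧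
      ip α β (yl α β (e u) (e v)) (yl α β (e u') (e v')) = 0 := by
  obtain ⟨hα, hβ⟩ := an_ne h
  rw [OrthoMeet, meet_iff e ha hb, perp_iff B ha hb]
  have e1 := det4 α β (e u) (e v) (e u') (e v')
  have e2 : 2 * (B u' u * B v' v - B v' u * B u' v) =
      c ^ 2 * (ip α β (xl α β (e u) (e v)) (xl α β (e u') (e v')) +
      ip α β (yl α β (e u) (e v)) (yl α β (e u') (e v'))) := by
    rw [hB, hB, hB, hB]
    simp [ip, xl, yl, pk]; ring
  have hab : 2 * α * β ≠ 0 := mul_ne_zero (mul_ne_zero h2 hα) hβ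
  constructor
  · rintro ⟨h3, h4⟩
    rw [h3] at e1
    rw [h4] at e2
    have e3 : ip α β (xl α β (e u) (e v)) (xl α β (e u') (e v')) +
      ip α β (yl α β (e u) (e v)) (yl α β (e u') (e v')) = 0 := by
      have : c ^ 2 ≠ 0 := pow_ne_zero _ hc
      apply mul_left_cancel₀ this; linear_combination -e2
    constructor
    · apply mul_left_cancel₀ h2; linear_combination e3 - e1
    · apply mul_left_cancel₀ h2; linear_combination e3 + e1
  · rintro ⟨h3, h4⟩
    rw [h3, h4] at e1 e2
    constructor
    · apply mul_left_cancel₀ hab; rw [e1]; ring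
    · apply mul_left_cancel₀ h2; rw [e2]; ring

theorem inj_line {F V : Type*} [Field F] [AddCommGroup V] [Module F V]
    {e : V ≃ₗ[F] (Fin 4 → F)} {α β : F} (h : An α β) (h2 : (2 : F) ≠ 0)
    {a b : Submodule F V} (fa : Module.finrank F a = 2) (fb : Module.finrank F b = 2)
    {u v u' v' : V} (ha : IsB a u v) (hb : IsB b u' v') {k : F}
    (hx : xl α β (e u) (e v) = k • xl α β (e u') (e v'))
    (hy : yl α β (e u) (e v) = k • yl α β (e u') (e v')) : a = b := by
  have : Module.Finite F V := Module.Finite.equiv e.symm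
  have hp := pk_prop h h2 hx hy
  have hR : ∀ i, e u i • v - e v i • u ∈ b := by
    intro i
    have : e u i • v - e v i • u = k • (e u' i • v' - e v' i • u') := by
      apply e.injective
      ext j
      have := hp i j
      simp only [pk] at this
      simp
      linear_combination this
    rw [this]
    exact b.smul_mem _ (b.sub_mem (b.smul_mem _ hb.2.1) (b.smul_mem _ hb.1))
  obtain ⟨i, j, hij⟩ := pk_ne (u := e u) (v := e v) (by
    intro s t hst
    apply ha.2.2.2
    apply e.injective
    simpa using hst)
  have hu : u ∈ b := by
    rw [← b.smul_mem_iff hij]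
    have : pk (e u) (e v) i j • u = e u j • (e u i • v - e v i • u) - e u i • (e u j • v - e v j • u) := by
      simp only [pk]; module
    rw [this]
    exact b.sub_mem (b.smul_mem _ (hR _)) (b.smul_mem _ (hR _))
  have hv : v ∈ b := by
    rw [← b.smul_mem_iff hij]
    have : pk (e u) (e v) i j • v = e v j • (e u i • v - e v i • u) - e v i • (e u j • v - e v j • u) := by
      simp only [pk]; module
    rw [this]
    exact b.sub_mem (b.smul_mem _ (hR _)) (b.smul_mem _ (hR _))
  apply Submodule.eq_of_le_of_finrank_eq
  · intro w hw
    obtain ⟨s, t, rfl⟩ := ha.2.2.1 w hw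
    exact b.add_mem (b.smul_mem _ hu) (b.smul_mem _ hv)
  · rw [fa, fb]

theorem surj_line {F V : Type*} [Field F] [AddCommGroup V] [Module F V]
    (e : V ≃ₗ[F] (Fin 4 → F)) {α β : F} (h : An α β) (h2 : (2 : F) ≠ 0)
    (x y : Fin 3 → F) (hx : x ≠ 0) (he : ip α β x x = ip α β y y) :
    ∃ a : Submodule F V, Module.finrank F a = 2 ∧ ∀ u v, IsB a u v → ∃ k : F, k ≠ 0 ∧
      xl α β (e u) (e v) = k • x ∧ yl α β (e u) (e v) = k • y := by
  obtain ⟨u, v, k, hk, e1, e2⟩ := surj_vec h h2 x y hx he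
  have hind : ∀ s t : F, s • e.symm u + t • e.symm v = 0 → s = 0 ∧ t = 0 := by
    by_contra hc
    have : ∀ i j, pk u v i j = 0 := by
      intro i j
      by_contra hp
      apply hc
      intro s t hst
      apply ind_of_pk hp
      have := congrArg e hst
      simpa using this
    have hz : xl α β u v = 0 := by
      ext i; fin_cases i <;> simp [xl, this]
    rw [e1] at hz
    exact (smul_ne_zero hk hx) hz
  refine ⟨Submodule.span F (Set.range ![e.symm u, e.symm v]), ?_, ?_⟩
  · rw [finrank_span_eq_card]
    · simp
    · rw [LinearIndependent.pair_iff]; exact hind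
  · intro u1 v1 hb
    obtain ⟨a, b, h3⟩ := hb.2.2.1 (e.symm u) (Submodule.subset_span ⟨0, rfl⟩)
    obtain ⟨c, d, h4⟩ := hb.2.2.1 (e.symm v) (Submodule.subset_span ⟨1, rfl⟩)
    have h3' : u = a • e u1 + b • e v1 := by simpa using congrArg e h3
    have h4' : v = c • e u1 + d • e v1 := by simpa using congrArg e h4
    obtain ⟨c1, c2⟩ := xl_comb α β (e u1) (e v1) a b c d
    rw [← h3', ← h4'] at c1 c2
    rw [e1] at c1
    rw [e2] at c2
    have hD : a * d - b * c ≠ 0 := by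
      intro h0
      rw [h0, zero_smul] at c1
      exact (smul_ne_zero hk hx) c1
    refine ⟨(a * d - b * c)⁻¹ * k, mul_ne_zero (inv_ne_zero hD) hk, ?_, ?_⟩
    · rw [mul_smul, c1, smul_smul, inv_mul_cancel₀ hD, one_smul]
    · rw [mul_smul, c2, smul_smul, inv_mul_cancel₀ hD, one_smul]

end coord

section fin

theorem fin_coord {F V : Type*} [Field F] [AddCommGroup V] [Module F V] {B : LinearMap.BilinForm F V}
    {e : V ≃ₗ[F] (Fin 4 → F)} {c α β : F} (hB : Coo B e c α β) (hc : c ≠ 0) (h : An α β)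
    (h2 : (2 : F) ≠ 0) (φ : ELine F V → ELine F V) (hinj : Function.Injective φ)
    (hφ : ∀ a b : ELine F V, Related B a.1 b.1 → Related B (φ a).1 (φ b).1)
    (a b : ELine F V) (hab : Related B (φ a).1 (φ b).1) : Related B a.1 b.1 := by
  choose U W hUW using fun a : ELine F V => exB a.1 a.2
  have hne : ∀ a, xl α β (e (U a)) (e (W a)) ≠ 0 ∧ yl α β (e (U a)) (e (W a)) ≠ 0 := by
    intro a
    obtain ⟨i, j, hij⟩ := pk_ne (u := e (U a)) (v := e (W a)) (by
      intro s t hst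
      apply (hUW a).2.2.2
      apply e.injective
      simpa using hst)
    exact xl_ne h h2 hij
  let l : ELine F V → Projectivization F (Fin 3 → F) := fun a => Projectivization.mk F _ (hne a).1
  let r : ELine F V → Projectivization F (Fin 3 → F) := fun a => Projectivization.mk F _ (hne a).2
  have hom : ∀ a b, OrthoMeet B a.1 b.1 ↔ ppr α β (l a) (l b) ∧ ppr α β (r a) (r b) := by
    intro a b
    rw [ppr_mk, ppr_mk]
    exact ortho_iff hB hc h h2 (hUW a) (hUW b)
  have H := plane_epl h h2
  have hirr : ∀ a b : ELine F V, OrthoMeet B a.1 b.1 → a ≠ b := by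
    rintro a b hm rfl
    exact H.ne ((hom _ _).1 hm).1 rfl
  have hlr : ∀ a, cls α β (l a) (r a) := by
    intro a
    rw [cls_mk]
    exact ⟨1, one_ne_zero, by rw [ip_xl_yl]; ring⟩
  have hex : ∀ X Y, cls α β X Y → ∃ a b, a ≠ b ∧ l a = X ∧ r a = Y ∧ l b = X ∧ r b = Y ∧
      ∀ c, l c = X → r c = Y → c = a ∨ c = b := by
    intro X Y hXY
    induction X using Projectivization.ind with | h x hx
    induction Y using Projectivization.ind with | h y hy
    rw [cls_mk] at hXY
    obtain ⟨t, ht, hxy⟩ := hXY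
    have ex : ∀ s : F, s ≠ 0 → s ^ 2 = t ^ 2 → ∃ a, ∃ k : F, k ≠ 0 ∧
        xl α β (e (U a)) (e (W a)) = k • x ∧ yl α β (e (U a)) (e (W a)) = (k * s) • y ∧
        l a = Projectivization.mk F x hx ∧ r a = Projectivization.mk F y hy := by
      intro s hs hst
      obtain ⟨a, fa, hk⟩ := surj_line (V := V) e h h2 x (s • y) hx (by
        rw [ip_smul_left', ip_smul_right', hxy, ← hst]; ring)
      obtain ⟨k, hk, e1, e2⟩ := hk _ _ (hUW ⟨a, fa⟩)
      rw [smul_smul] at e2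
      refine ⟨⟨a, fa⟩, k, hk, e1, e2, ?_, ?_⟩
      · exact (Projectivization.mk_eq_mk_iff' F _ _ _ _).2 ⟨k, e1.symm⟩
      · exact (Projectivization.mk_eq_mk_iff' F _ _ _ _).2 ⟨k * s, e2.symm⟩
    obtain ⟨a, k, hk, a1, a2, a3, a4⟩ := ex t ht rfl
    obtain ⟨b, j, hj, b1, b2, b3, b4⟩ := ex (-t) (neg_ne_zero.2 ht) (by ring)
    refine ⟨a, b, ?_, a3, a4, b3, b4, ?_⟩
    · rintro rfl
      have e1 : k = j := smul_left_injective F hx (a1.symm.trans b1)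
      have e2 : k * t = j * -t := smul_left_injective F hy (a2.symm.trans b2)
      subst e1
      have : 2 * (k * t) = 0 := by linear_combination e2
      exact mul_ne_zero h2 (mul_ne_zero hk ht) this
    · intro c c1 c2
      obtain ⟨p, hp⟩ := (Projectivization.mk_eq_mk_iff' F _ _ _ _).1 c1
      obtain ⟨q, hq⟩ := (Projectivization.mk_eq_mk_iff' F _ _ _ _).1 c2
      have hpq := ip_xl_yl α β (e (U c)) (e (W c))
      rw [← hp, ← hq] at hpq
      simp only [ip_smul_left', ip_smul_right'] at hpq
      have hy0 : ip α β y y ≠ 0 := fun h0 => hy (h _ h0)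
      have h4 : (q - p * t) * (q + p * t) = 0 := by
        apply mul_left_cancel₀ hy0
        linear_combination -hpq + p * p * hxy
      rcases mul_eq_zero.1 h4 with h5 | h5
      · left
        apply Subtype.ext
        apply inj_line (e := e) h h2 c.2 a.2 (hUW c) (hUW a) (k := p / k)
        · rw [a1, ← hp, smul_smul, div_mul_cancel₀ _ hk]
        · rw [a2, ← hq, smul_smul, ← mul_assoc, div_mul_cancel₀ _ hk, sub_eq_zero.1 h5]
      · right
        apply Subtype.ext
        apply inj_line (e := e) h h2 c.2 b.2 (hUW c) (hUW b) (k := p / j)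
        · rw [b1, ← hp, smul_smul, div_mul_cancel₀ _ hj]
        · rw [b2, ← hq, smul_smul, ← mul_assoc, div_mul_cancel₀ _ hj, eq_neg_of_add_eq_zero_left h5,
            mul_neg]
  rcases hab with hab | hab
  · left
    rw [hom] at hab ⊢
    refine H.main l r hlr hex φ hinj ?_ a b hab.1 hab.2
    intro a b p1 p2
    have hm := (hom a b).2 ⟨p1, p2⟩
    rw [← hom]
    rcases hφ a b (Or.inl hm) with h3 | h3
    · exact h3
    · exact absurd (hinj (Subtype.ext h3)) (hirr _ _ hm)
  · right
    rw [hinj (Subtype.ext hab)]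

theorem coo_an {F V : Type*} [Field F] [AddCommGroup V] [Module F V] {B : LinearMap.BilinForm F V}
    (haniso : ∀ x : V, B x x = 0 → x = 0)
    {e : V ≃ₗ[F] (Fin 4 → F)} {c α β : F} (hB : Coo B e c α β) : c ≠ 0 ∧ An α β := by
  constructor
  · rintro rfl
    have h0 := haniso (e.symm ![1, 0, 0, 0]) (by rw [hB]; ring)
    have := congrFun (congrArg e h0) 0
    simp at this
  · intro x hx
    have h0 := haniso (e.symm ![0, x 0, x 1, x 2]) (by
      rw [hB]; simp only [ip] at hx; simp; right; linear_combination hx)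
    have h1 := congrFun (congrArg e h0) 1
    have h2 := congrFun (congrArg e h0) 2
    have h3 := congrFun (congrArg e h0) 3
    simp at h1 h2 h3
    ext i; fin_cases i <;> assumption

end fin

section cla

theorem two_span {F V : Type*} [Field F] [AddCommGroup V] [Module F V]
    {W : Submodule F V} (hW : Module.finrank F W = 2) {p q : V} (hp : p ∈ W) (hq : q ∈ W)
    (hi : ∀ s t : F, s • p + t • q = 0 → s = 0 ∧ t = 0) : IsB W p q := by
  refine ⟨hp, hq, ?_, hi⟩
  have : Module.Finite F W := Module.finite_of_finrank_pos (by omega)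
  have hle : Submodule.span F (Set.range ![p, q]) ≤ W := by
    rw [Submodule.span_le]
    rintro _ ⟨i, rfl⟩
    fin_cases i
    exacts [hp, hq]
  have heq : Submodule.span F (Set.range ![p, q]) = W := by
    apply Submodule.eq_of_le_of_finrank_eq hle
    rw [hW, finrank_span_eq_card]
    · simp
    · rw [LinearIndependent.pair_iff]; exact hi
  intro w hw
  rw [← heq] at hw
  simp only [Matrix.range_cons, Matrix.range_empty, Set.union_empty, Set.singleton_union] at hw
  obtain ⟨s, t, h⟩ := Submodule.mem_span_pair.1 hw
  exact ⟨s, t, h.symm⟩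

theorem ind_of_nonprop {F V : Type*} [Field F] [AddCommGroup V] [Module F V] {p q : V}
    (hp : p ≠ 0) (hq : ∀ i : F, q ≠ i • p) (s t : F) (h : s • p + t • q = 0) : s = 0 ∧ t = 0 := by
  have ht : t = 0 := by
    by_contra ht
    apply hq (t⁻¹ * -s)
    rw [mul_smul, neg_smul, neg_eq_of_add_eq_zero_right h, smul_smul, inv_mul_cancel₀ ht, one_smul]
  subst ht
  rw [zero_smul, add_zero, smul_eq_zero] at h
  exact ⟨h.resolve_right hp, rfl⟩

theorem isB_le {F V : Type*} [Field F] [AddCommGroup V] [Module F V]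
    {W W' : Submodule F V} {p q : V} (h : IsB W p q) (hp : p ∈ W') (hq : q ∈ W') : W ≤ W' := by
  intro w hw
  obtain ⟨s, t, rfl⟩ := h.2.2.1 w hw
  exact W'.add_mem (W'.smul_mem _ hp) (W'.smul_mem _ hq)

theorem two_eq {F V : Type*} [Field F] [AddCommGroup V] [Module F V]
    {W W' : Submodule F V} (hW : Module.finrank F W = 2) (hW' : Module.finrank F W' = 2) {p q : V}
    (hp : p ∈ W) (hq : q ∈ W) (hp' : p ∈ W') (hq' : q ∈ W')
    (hi : ∀ s t : F, s • p + t • q = 0 → s = 0 ∧ t = 0) : W = W' :=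
  le_antisymm (isB_le (two_span hW hp hq hi) hp' hq') (isB_le (two_span hW' hp' hq' hi) hp hq)

/-- orthogonal projection onto `b` -/
structure OPr {F V : Type*} [Field F] [AddCommGroup V] [Module F V] (B : LinearMap.BilinForm F V)
    (b : Submodule F V) (π : V →ₗ[F] V) : Prop where
  mem : ∀ v, π v ∈ b
  on : ∀ v ∈ b, π v = v
  off : ∀ v, (∀ w ∈ b, B w v = 0) → π v = 0
  off' : ∀ v, π v = 0 → v ∈ B.orthogonal b
  adj : ∀ u v, B (π u) v = B u (π v)

theorem ex_opr {F V : Type*} [Field F] [AddCommGroup V] [Module F V] [FiniteDimensional F V]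
    (B : LinearMap.BilinForm F V) (hs : ∀ u v, B u v = B v u) (haniso : ∀ x : V, B x x = 0 → x = 0)
    (b : Submodule F V) : ∃ π, OPr B b π := by
  have hrefl : B.IsRefl := fun u v h => by rw [hs]; exact h
  have hc : IsCompl b (B.orthogonal b) := by
    rw [LinearMap.BilinForm.isCompl_orthogonal_iff_disjoint hrefl, Submodule.disjoint_def]
    intro x h1 h2
    exact haniso x (h2 x h1)
  have hm : ∀ v, ∃ w ∈ b, v - w ∈ B.orthogonal b := by
    intro v
    have : v ∈ b ⊔ B.orthogonal b := by rw [hc.sup_eq_top]; trivial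
    obtain ⟨y, hy, z, hz, rfl⟩ := Submodule.mem_sup.1 this
    exact ⟨y, hy, by simpa using hz⟩
  let π : V →ₗ[F] V := b.subtype ∘ₗ b.projectionOnto _ hc
  have m1 : ∀ v, π v ∈ b := fun v => Submodule.coe_mem _
  have m2 : ∀ v ∈ b, π v = v := by
    intro v hv
    change ((b.projectionOnto _ hc) ((⟨v, hv⟩ : b) : V) : V) = v
    rw [Submodule.projectionOnto_apply_left]
  have m3 : ∀ v ∈ B.orthogonal b, π v = 0 := by
    intro v hv
    change ((b.projectionOnto _ hc) ((⟨v, hv⟩ : B.orthogonal b) : V) : V) = 0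
    rw [Submodule.projectionOnto_apply_right]; rfl
  have m4 : ∀ v, v - π v ∈ B.orthogonal b := by
    intro v
    obtain ⟨w, hw, hv⟩ := hm v
    have : π v = w := by
      have := m3 _ hv
      rw [map_sub, m2 w hw] at this
      exact sub_eq_zero.1 this
    rwa [this]
  have m5 : ∀ u v, B (π u) v = B (π u) (π v) := by
    intro u v
    have := m4 v (π u) (m1 u)
    change B (π u) (v - π v) = 0 at this
    rw [map_sub] at this
    exact sub_eq_zero.1 this
  refine ⟨π, m1, m2, fun v hv => m3 v hv, ?_, ?_⟩
  · intro v hv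
    have := m4 v
    rwa [hv, sub_zero] at this
  · intro u v
    rw [m5, hs u, m5 v u, hs]

/-- data of a line meeting `a` and `b` orthogonally -/
structure LD {F V : Type*} [Field F] [AddCommGroup V] [Module F V] (B : LinearMap.BilinForm F V)
    (a x : Submodule F V) (π : V →ₗ[F] V) (p q : V) : Prop where
  fx : Module.finrank F x = 2
  hb : IsB x p q
  p0 : p ≠ 0
  q0 : q ≠ 0
  pa : p ∈ a
  qa : ∀ w ∈ a, B w q = 0
  sp : ∃ k l : F, π p = k • p + l • q
  sq : ∃ k l : F, π q = k • p + l • q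
  r1 : ∃ r ∈ x, r ≠ 0 ∧ π r = r
  r2 : ∃ r ∈ x, r ≠ 0 ∧ π r = 0

theorem ex_ld {F V : Type*} [Field F] [AddCommGroup V] [Module F V]
    {B : LinearMap.BilinForm F V} (haniso : ∀ x : V, B x x = 0 → x = 0)
    {a b x : Submodule F V} {π : V →ₗ[F] V} (hπ : OPr B b π) (fx : Module.finrank F x = 2)
    (h1 : OrthoMeet B x a) (h2 : OrthoMeet B x b) : ∃ p q, LD B a x π p q := by
  have key : ∀ c, OrthoMeet B x c → ∃ p q, IsB x p q ∧ p ≠ 0 ∧ q ≠ 0 ∧ p ∈ c ∧ ∀ w ∈ c, B w q = 0 := by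
    intro c hc
    obtain ⟨p, hp, hp0⟩ := (Submodule.ne_bot_iff _).1 hc.1
    obtain ⟨q, hq, hq0⟩ := (Submodule.ne_bot_iff _).1 hc.2
    have hq2 : ∀ w ∈ c, B w q = 0 := hq.2
    refine ⟨p, q, two_span fx hp.1 hq.1 ?_, hp0, hq0, hp.2, hq2⟩
    apply ind_of_nonprop hp0
    rintro i rfl
    have h3 := hq2 _ hp.2
    rw [map_smul, smul_eq_mul] at h3
    rcases mul_eq_zero.1 h3 with h3 | h3
    · apply hq0; rw [h3, zero_smul]
    · exact hp0 (haniso _ h3)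
  obtain ⟨p, q, hb, p0, q0, pa, qa⟩ := key a h1
  obtain ⟨r, s, hb', r0, s0, rb, sb⟩ := key b h2
  have er := hπ.on r rb
  have es := hπ.off s sb
  have hx : ∀ w ∈ x, π w ∈ x := by
    intro w hw
    obtain ⟨i, j, rfl⟩ := hb'.2.2.1 w hw
    rw [map_add, map_smul, map_smul, er, es, smul_zero, add_zero]
    exact x.smul_mem _ hb'.1
  exact ⟨p, q, fx, hb, p0, q0, pa, qa, hb.2.2.1 _ (hx _ hb.1), hb.2.2.1 _ (hx _ hb.2.1),
    ⟨r, hb'.1, r0, er⟩, ⟨s, hb'.2.1, s0, es⟩⟩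

theorem LD.alt {F V : Type*} [Field F] [AddCommGroup V] [Module F V]
    {B : LinearMap.BilinForm F V} (hs : ∀ u v, B u v = B v u) (haniso : ∀ x : V, B x x = 0 → x = 0)
    {a b x : Submodule F V} {π : V →ₗ[F] V} (hπ : OPr B b π) {p q : V} (h : LD B a x π p q)
    {k : F} (hk : π p = k • p) : (k = 1 ∧ π q = 0) ∨ (k = 0 ∧ π q = q) := by
  have hid : ∀ v, π (π v) = π v := fun v => hπ.on _ (hπ.mem v)
  have idem : ∀ (v : V) (k : F), v ≠ 0 → π v = k • v → k = 0 ∨ k = 1 := by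
    intro v k hv e
    have := hid v
    rw [e, map_smul, e, smul_smul] at this
    have h3 : k * k = k := smul_left_injective F hv this
    have h4 : k * (k - 1) = 0 := by linear_combination h3
    rcases mul_eq_zero.1 h4 with h5 | h5
    · exact Or.inl h5
    · exact Or.inr (sub_eq_zero.1 h5)
  obtain ⟨m, n, hq⟩ := h.sq
  have hpq : B p q = 0 := h.qa p h.pa
  have hm : m = 0 := by
    have e1 : B (π p) q = B p (π q) := hπ.adj p q
    rw [hk, hq] at e1
    simp [hpq] at e1
    rcases e1 with e1 | e1
    · exact e1
    · exact absurd (haniso _ e1) h.p0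
  rw [hm, zero_smul, zero_add] at hq
  obtain ⟨r, hr, r0, er⟩ := h.r1
  obtain ⟨s, hs', s0, es⟩ := h.r2
  rcases idem p k h.p0 hk with rfl | rfl
  · right
    refine ⟨rfl, ?_⟩
    rcases idem q n h.q0 hq with rfl | rfl
    · exfalso
      obtain ⟨i, j, rfl⟩ := h.hb.2.2.1 r hr
      apply r0
      rw [← er, map_add, map_smul, map_smul, hk, hq]; simp
    · rw [hq, one_smul]
  · left
    refine ⟨rfl, ?_⟩
    rcases idem q n h.q0 hq with rfl | rfl
    · rw [hq, zero_smul]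
    · exfalso
      obtain ⟨i, j, rfl⟩ := h.hb.2.2.1 s hs'
      apply s0
      rw [map_add, map_smul, map_smul, hk, hq, one_smul, one_smul] at es
      exact es

theorem LD.nonprop {F V : Type*} [Field F] [AddCommGroup V] [Module F V] [FiniteDimensional F V]
    {B : LinearMap.BilinForm F V} (hs : ∀ u v, B u v = B v u) (haniso : ∀ x : V, B x x = 0 → x = 0)
    (hn : B.Nondegenerate)
    {a b x y : Submodule F V} {π : V →ₗ[F] V} (hπ : OPr B b π)
    (fa' : Module.finrank F (B.orthogonal a) = 2)
    (fb : Module.finrank F b = 2) (fb' : Module.finrank F (B.orthogonal b) = 2)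
    (hba : b ≠ a) (hba' : b ≠ B.orthogonal a) (hxy : x ≠ y)
    {p q p' q' : V} (h : LD B a x π p q) (h' : LD B a y π p' q') (j : F) : p' ≠ j • p := by
  rintro rfl
  have hrefl : B.IsRefl := fun u v h => by rw [hs]; exact h
  have hj : j ≠ 0 := by rintro rfl; exact h'.p0 (zero_smul _ _)
  have hqq : ∀ i : F, q' ≠ i • q := by
    rintro i rfl
    apply hxy
    exact two_eq h.fx h'.fx (x.smul_mem _ h.hb.1) (x.smul_mem _ h.hb.2.1) h'.hb.1 h'.hb.2.1 h'.hb.2.2.2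
  obtain ⟨k, l, e1⟩ := h.sp
  obtain ⟨k', l', e2⟩ := h'.sp
  have e3 : j • l • q = l' • q' := by
    have e4 : (k' * j - j * k) • p = j • l • q - l' • q' := by
      rw [map_smul, e1] at e2
      rw [← sub_eq_zero] at e2 ⊢
      rw [← neg_eq_zero, ← e2]; module
    have e5 : B p (j • l • q - l' • q') = 0 := by
      rw [map_sub, map_smul, map_smul, map_smul, h.qa p h.pa, h'.qa p h.pa]; simp
    rw [← sub_eq_zero, ← e4]
    rw [← e4, map_smul, smul_eq_mul] at e5
    rcases mul_eq_zero.1 e5 with e6 | e6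
    · rw [e6, zero_smul]
    · exact absurd (haniso _ e6) h.p0
  have hind := ind_of_nonprop h.q0 hqq
  have hl : l = 0 := by
    have := (hind (j * l) (-l') (by rw [mul_smul, e3]; module)).1
    exact (mul_eq_zero.1 this).resolve_left hj
  rw [hl, zero_smul, add_zero] at e1
  have e1' : π (j • p) = k • (j • p) := by rw [map_smul, e1, smul_comm]
  have qa : q ∈ B.orthogonal a := h.qa
  have qa' : q' ∈ B.orthogonal a := h'.qa
  rcases h.alt hs haniso hπ e1 with ⟨rfl, hq⟩ | ⟨rfl, hq⟩
  · rcases h'.alt hs haniso hπ e1' with ⟨_, hq'⟩ | ⟨h0, _⟩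
    · have := two_eq fa' fb' qa qa' (hπ.off' _ hq) (hπ.off' _ hq') hind
      apply hba
      rw [← LinearMap.BilinForm.orthogonal_orthogonal hn hrefl b, ← this,
        LinearMap.BilinForm.orthogonal_orthogonal hn hrefl]
    · exact one_ne_zero h0
  · rcases h'.alt hs haniso hπ e1' with ⟨h0, _⟩ | ⟨_, hq'⟩
    · exact zero_ne_one h0
    · apply hba'
      exact (two_eq fa' fb qa qa' (hq ▸ hπ.mem q) (hq' ▸ hπ.mem q') hind).symm

theorem coo_of_orth {F V : Type*} [Field F] [AddCommGroup V] [Module F V] [FiniteDimensional F V]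
    (hdim : Module.finrank F V = 4) {B : LinearMap.BilinForm F V} (f : Fin 4 → V) (d : Fin 4 → F)
    (hf : ∀ i j, B (f i) (f j) = if i = j then d i else 0) (hd : ∀ i, d i ≠ 0) :
    ∃ e : V ≃ₗ[F] (Fin 4 → F), ∀ u v, B u v = d 0 * (e u 0 * e v 0) + d 1 * (e u 1 * e v 1) +
      d 2 * (e u 2 * e v 2) + d 3 * (e u 3 * e v 3) := by
  have hli : LinearIndependent F f := by
    rw [Fintype.linearIndependent_iff]
    intro g hg i
    have := congrArg (B (f i)) hg
    rw [map_sum, map_zero] at this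
    simp [hf] at this
    exact this.resolve_right (hd i)
  let bs := basisOfLinearIndependentOfCardEqFinrank hli (by simp [hdim])
  refine ⟨bs.equivFun, fun u v => ?_⟩
  have hbs : ∀ i, bs i = f i := fun i => by simp [bs]
  conv_lhs => rw [← bs.sum_equivFun u, ← bs.sum_equivFun v]
  simp only [hbs, map_sum, LinearMap.sum_apply, map_smul, LinearMap.smul_apply, hf, smul_eq_mul]
  simp [Fin.sum_univ_four]
  ring

theorem ex_coo {F V : Type*} [Field F] [AddCommGroup V] [Module F V]
    (hdim : Module.finrank F V = 4) (B : LinearMap.BilinForm F V) (hs : ∀ u v, B u v = B v u)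
    (haniso : ∀ x : V, B x x = 0 → x = 0) (hn : B.Nondegenerate) (hcl : IsClassical B) :
    ∃ (e : V ≃ₗ[F] (Fin 4 → F)) (c α β : F), Coo B e c α β := by
  have : FiniteDimensional F V := Module.finite_of_finrank_pos (by omega)
  have hrefl : B.IsRefl := fun u v h => by rw [hs]; exact h
  obtain ⟨a, b, fa, fb, ⟨x, y, z, fx, fy, fz, hxy, hxz, hyz, xa, xb, ya, yb, za, zb⟩, hba, hba'⟩ := hcl
  have fa' : Module.finrank F (B.orthogonal a) = 2 := by
    rw [LinearMap.BilinForm.finrank_orthogonal hn, hdim, fa]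
  have fb' : Module.finrank F (B.orthogonal b) = 2 := by
    rw [LinearMap.BilinForm.finrank_orthogonal hn, hdim, fb]
  obtain ⟨π, hπ⟩ := ex_opr B hs haniso b
  obtain ⟨p1, q1, L1⟩ := ex_ld haniso hπ fx xa xb
  obtain ⟨p2, q2, L2⟩ := ex_ld haniso hπ fy ya yb
  obtain ⟨p3, q3, L3⟩ := ex_ld haniso hπ fz za zb
  have n12 := L1.nonprop hs haniso hn hπ fa' fb fb' hba hba' hxy L2
  have n13 := L1.nonprop hs haniso hn hπ fa' fb fb' hba hba' hxz L3
  have n23 := L2.nonprop hs haniso hn hπ fa' fb fb' hba hba' hyz L3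
  have i12 := ind_of_nonprop L1.p0 n12
  have b12 := two_span fa L1.pa L2.pa i12
  have hk : ∀ {x p q}, LD B a x π p q → ∃ k, ∀ v ∈ a, B (π p) v = k * B p v := by
    intro x p q h
    obtain ⟨k, l, e⟩ := h.sp
    refine ⟨k, fun v hv => ?_⟩
    rw [e, map_add, map_smul, map_smul]
    simp [hs q v, h.qa v hv]
  obtain ⟨k1, e1⟩ := hk L1
  obtain ⟨k2, e2⟩ := hk L2
  obtain ⟨k3, e3⟩ := hk L3
  obtain ⟨c, d, h3⟩ := b12.2.2.1 p3 L3.pa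
  have hc : c ≠ 0 := by
    rintro rfl; exact n23 d (by rw [h3, zero_smul, zero_add])
  have hd : d ≠ 0 := by
    rintro rfl; exact n13 c (by rw [h3, zero_smul, add_zero])
  have hz : (c * (k3 - k1)) • p1 + (d * (k3 - k2)) • p2 = 0 := by
    apply haniso
    have hm : (c * (k3 - k1)) • p1 + (d * (k3 - k2)) • p2 ∈ a :=
      a.add_mem (a.smul_mem _ L1.pa) (a.smul_mem _ L2.pa)
    generalize hw : (c * (k3 - k1)) • p1 + (d * (k3 - k2)) • p2 = w at hm
    nth_rewrite 1 [← hw]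
    have f1 := e1 w hm
    have f2 := e2 w hm
    have f3 := e3 w hm
    rw [h3] at f3
    simp at f3
    simp
    rw [f1, f2] at f3
    linear_combination -f3
  obtain ⟨z1, z2⟩ := i12 _ _ hz
  have k31 := sub_eq_zero.1 ((mul_eq_zero.1 z1).resolve_left hc)
  have k32 := sub_eq_zero.1 ((mul_eq_zero.1 z2).resolve_left hd)
  rw [← k31] at e1
  rw [← k32] at e2
  generalize k3 = k at e1 e2
  have hkk : ∀ u ∈ a, ∀ v ∈ a, B (π u) v = k * B u v := by
    intro u hu v hv
    obtain ⟨s, t, rfl⟩ := b12.2.2.1 u hu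
    simp [e1 v hv, e2 v hv]; ring
  have hpp : ∀ u v, B (π u) (π v) = B (π u) v := by
    intro u v
    rw [hπ.adj, hπ.adj, hπ.on _ (hπ.mem v)]
  have k0 : k ≠ 0 := by
    rintro rfl
    have hz : ∀ u ∈ a, π u = 0 := by
      intro u hu
      apply haniso
      rw [hpp, hkk u hu u hu, zero_mul]
    have : a = B.orthogonal b := two_eq fa fb' L1.pa L2.pa (hπ.off' _ (hz _ L1.pa))
      (hπ.off' _ (hz _ L2.pa)) i12
    apply hba'
    rw [this, LinearMap.BilinForm.orthogonal_orthogonal hn hrefl]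
  have k1 : 1 - k ≠ 0 := by
    intro h0
    have hz : ∀ u ∈ a, u ∈ b := by
      intro u hu
      have : u - π u = 0 := by
        apply haniso
        have f1 := hkk u hu u hu
        have f2 := hpp u u
        have f3 := hs u (π u)
        simp only [map_sub, LinearMap.sub_apply]
        linear_combination (-1 : F) * f3 - f1 + f2 + h0 * B u u
      rw [sub_eq_zero.1 this]
      exact hπ.mem u
    exact hba (two_eq fa fb L1.pa L2.pa (hz _ L1.pa) (hz _ L2.pa) i12).symm
  have d10 : B p1 p1 ≠ 0 := fun h => L1.p0 (haniso _ h)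
  obtain ⟨u, hu⟩ : ∃ u, u = B p1 p1 • p2 - B p1 p2 • p1 := ⟨_, rfl⟩
  have ua : u ∈ a := by rw [hu]; exact a.sub_mem (a.smul_mem _ L2.pa) (a.smul_mem _ L1.pa)
  have o1 : B p1 u = 0 := by rw [hu]; simp; ring
  have o2 : B u p1 = 0 := by rw [hs, o1]
  have u0 : u ≠ 0 := by
    intro h0
    apply d10
    refine (i12 (- B p1 p2) (B p1 p1) ?_).2
    rw [← h0, hu]; module
  have du : B u u ≠ 0 := fun h => u0 (haniso _ h)
  have hpu := hπ.adj
  have g1 : ∀ u v, B (π u) (v - π v) = 0 := by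
    intro u v; rw [map_sub, hpp, sub_self]
  have g2 : ∀ u v, B (v - π v) (π u) = 0 := by
    intro u v; rw [hs, g1]
  have g3 : ∀ u ∈ a, ∀ v ∈ a, B (π u) (π v) = k * B u v := by
    intro u hu v hv; rw [hpp, hkk u hu v hv]
  have g4 : ∀ u ∈ a, ∀ v ∈ a, B (u - π u) (v - π v) = (1 - k) * B u v := by
    intro u hu v hv
    have := g1 u v
    have := hπ.adj u v
    have := hkk u hu v hv
    rw [map_sub B, LinearMap.sub_apply, g1, map_sub, ← hπ.adj, hkk u hu v hv]; ring
  obtain ⟨e, he⟩ := coo_of_orth hdim (B := B) ![π p1, π u, p1 - π p1, u - π u]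
    ![k * B p1 p1, k * B u u, (1 - k) * B p1 p1, (1 - k) * B u u] (by
      intro i j
      fin_cases i <;> fin_cases j <;>
        simp [-map_sub, g1, g2, g3 _ L1.pa _ L1.pa, g3 _ L1.pa _ ua, g3 _ ua _ L1.pa, g3 _ ua _ ua,
          g4 _ L1.pa _ L1.pa, g4 _ L1.pa _ ua, g4 _ ua _ L1.pa, g4 _ ua _ ua, o1, o2]) (by
      intro i
      fin_cases i
      exacts [mul_ne_zero k0 d10, mul_ne_zero k0 du, mul_ne_zero k1 d10, mul_ne_zero k1 du])
  refine ⟨e, k * B p1 p1, B u u / B p1 p1, (1 - k) / k, fun v w => ?_⟩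
  rw [he]
  simp
  field_simp

end cla

/-- **Theorem 1.** In a 3-dimensional classical elliptic space, any bijection `φ` of the set of
lines with `a ∼ b → φ(a) ∼ φ(b)` is an elliptic Plücker transformation. -/
theorem bijection_preserving_related_is_pluecker
    (hdim : Module.finrank F V = 4)
    (B : LinearMap.BilinForm F V)
    (hsymm : B.IsSymm)
    (hnondeg : B.Nondegenerate)
    (haniso : ∀ x : V, B x x = 0 → x = 0)
    (hchar : (2 : F) ≠ 0)
    (hclassical : IsClassical B)
    (φ : ELine F V → ELine F V)
    (hbij : Function.Bijective φ)
    (hφ : ∀ a b : ELine F V, Related B a.1 b.1 → Related B (φ a).1 (φ b).1) :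
    ∀ a b : ELine F V, Related B a.1 b.1 ↔ Related B (φ a).1 (φ b).1 := by
  have hs : ∀ u v, B u v = B v u := fun u v => hsymm.eq u v
  obtain ⟨e, c, α, β, hB⟩ := ex_coo hdim B hs haniso hnondeg hclassical
  obtain ⟨hc, hA⟩ := coo_an haniso hB
  intro a b
  exact ⟨hφ a b, fin_coord hB hc hA hchar φ hbij.1 hφ a b⟩
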